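/- arXiv:2210.00656 — 4 statements merged into one kernel-verified Lean document; each statement's English description precedes it below -/
import Mathlib

section
/- Fix an integer ν ≥ 3. Suppose M = M(n) is a sequence of positive integers with M(n) → ∞ and log M(n) = O(n), and suppose n/log M(n) converges to a limit κ with κ > 2(ν−1)/log((1 − 2ν^{−2})^{−1}). Then for every δ ∈ (0,1), liminf_{n→∞} P( Z_n ≥ δ·E[Z_n] ) ≥ (1−δ)² / ((1−δ)² + ν²). -/
open Filter

/-- The number of perfect ordered partitions of `{1,…,n}` into `ν` nonempty parts. -/
noncomputable def perfectCount (ν n : ℕ) (X : Fin n → ℕ) : ℕ :=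
  Set.ncard {σ : Fin n → Fin ν | Function.Surjective σ ∧
    ∀ α β : Fin ν,
      (∑ j ∈ Finset.univ.filter fun j => σ j = α, X j) =
      (∑ j ∈ Finset.univ.filter fun j => σ j = β, X j)}

/-- `E[Z_n]` for `X_1,…,X_n` i.i.d. uniform on `{1,…,M}`. -/
noncomputable def EZ (ν n M : ℕ) : ℝ :=
  (∑ X : Fin n → Fin M, ((perfectCount ν n fun j => (X j : ℕ) + 1) : ℝ)) / (M : ℝ) ^ n

/-- `P(Z_n ≥ c)` for `X_1,…,X_n` i.i.d. uniform on `{1,…,M}`. -/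
noncomputable def prGE (ν n M : ℕ) (c : ℝ) : ℝ :=
  ((Set.ncard {X : Fin n → Fin M |
      c ≤ ((perfectCount ν n fun j => (X j : ℕ) + 1) : ℝ)}) : ℝ) / (M : ℝ) ^ n

open MeasureTheory Topology

section UniformCharacter

/-- The characteristic function of the uniform distribution on `{1, …, M}`. -/
noncomputable def unifChar (M : ℕ) (θ : UnitAddCircle) : ℂ :=
  (M : ℂ)⁻¹ * ∑ x : Fin M, fourier ((x : ℤ) + 1) θ

lemma continuous_unifChar (M : ℕ) : Continuous (unifChar M) := by
  unfold unifChar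
  fun_prop

lemma norm_fourier_apply (k : ℤ) (θ : UnitAddCircle) : ‖fourier k θ‖ = 1 := by
  rw [fourier_apply, Circle.norm_coe]

lemma norm_unifChar_le_one (M : ℕ) (θ : UnitAddCircle) : ‖unifChar M θ‖ ≤ 1 := by
  rw [unifChar, norm_mul, norm_inv, Complex.norm_natCast]
  rcases Nat.eq_zero_or_pos M with rfl | hM
  · simp
  have hM' : (0 : ℝ) < M := by exact_mod_cast hM
  rw [inv_mul_le_iff₀ hM', mul_one]
  refine (norm_sum_le _ _).trans ?_
  simp only [norm_fourier_apply]
  simp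

/-- The geometric sum bound. -/
lemma norm_unifChar_mul_sin_le (M : ℕ) (x : ℝ) :
    M * |Real.sin (Real.pi * x)| * ‖unifChar M (x : UnitAddCircle)‖ ≤ 1 := by
  rcases Nat.eq_zero_or_pos M with rfl | hM
  · simp
  have hM' : (0 : ℝ) < M := by exact_mod_cast hM
  set z : ℂ := Complex.exp (Complex.I * ((2 * Real.pi * x : ℝ) : ℂ)) with hz
  have hf : ∀ k : Fin M, fourier ((k : ℤ) + 1) (x : UnitAddCircle) = z * z ^ (k : ℕ) := by
    intro k
    rw [fourier_coe_apply, hz, ← Complex.exp_nat_mul, ← Complex.exp_add]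
    congr 1
    push_cast
    ring
  have hz1 : ‖z‖ = 1 := by
    rw [hz, mul_comm, Complex.norm_exp_ofReal_mul_I]
  have hzs : ‖z - 1‖ = 2 * |Real.sin (Real.pi * x)| := by
    rw [hz, Complex.norm_exp_I_mul_ofReal_sub_one, norm_mul]
    simp only [Real.norm_eq_abs]
    rw [show 2 * Real.pi * x / 2 = Real.pi * x by ring]
    simp
  have hg : (∑ k : Fin M, fourier ((k : ℤ) + 1) (x : UnitAddCircle)) * (z - 1)
      = z * (z ^ M - 1) := by
    rw [Finset.sum_congr rfl fun k _ => hf k, ← Finset.mul_sum, mul_assoc,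
      Fin.sum_univ_eq_sum_range (fun k => z ^ k), geom_sum_mul]
  have hn := congrArg norm hg
  rw [norm_mul, norm_mul, hz1, hzs, one_mul] at hn
  have h2 : ‖z ^ M - 1‖ ≤ 2 := by
    refine (norm_sub_le _ _).trans ?_
    rw [norm_pow, hz1]
    norm_num
  rw [unifChar, norm_mul, norm_inv, Complex.norm_natCast]
  have : (M : ℝ) * |Real.sin (Real.pi * x)| *
      ((M : ℝ)⁻¹ * ‖∑ k : Fin M, fourier ((k : ℤ) + 1) (x : UnitAddCircle)‖) =
      |Real.sin (Real.pi * x)| * ‖∑ k : Fin M, fourier ((k : ℤ) + 1) (x : UnitAddCircle)‖ := by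
    field_simp
  rw [this]
  linarith

lemma exists_real_rep (θ : UnitAddCircle) : ∃ x : ℝ, (x : UnitAddCircle) = θ ∧ |x| = ‖θ‖ ∧
    |x| ≤ 1 / 2 := by
  induction θ using QuotientAddGroup.induction_on with
  | H y =>
    refine ⟨y - round y, ?_, ?_, abs_sub_round y⟩
    · have : ((round y : ℝ) : UnitAddCircle) = 0 := by
        rw [AddCircle.coe_eq_zero_iff]
        exact ⟨round y, by simp⟩
      have h := AddCircle.coe_sub (p := (1 : ℝ)) y (round y : ℝ)
      exact h.trans (by rw [this, sub_zero])
    · exact (UnitAddCircle.norm_eq (x := y)).symm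

lemma two_mul_abs_le_abs_sin {x : ℝ} (hx : |x| ≤ 1 / 2) : 2 * |x| ≤ |Real.sin (Real.pi * x)| := by
  have h := Real.mul_le_sin (x := Real.pi * |x|) (by positivity)
    (by nlinarith [Real.pi_pos])
  have h2 : |Real.sin (Real.pi * x)| = |Real.sin (Real.pi * |x|)| := by
    rcases abs_choice x with h | h <;> rw [h]
    rw [mul_neg, Real.sin_neg, abs_neg]
  rw [h2]
  refine le_trans ?_ (le_abs_self _)
  calc 2 * |x| = 2 / Real.pi * (Real.pi * |x|) := by field_simp
    _ ≤ _ := h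

lemma norm_unifChar_le_third (M : ℕ) (θ : UnitAddCircle) (h : 3 / 2 ≤ M * ‖θ‖) :
    ‖unifChar M θ‖ ≤ 1 / 3 := by
  obtain ⟨x, rfl, hx, hx2⟩ := exists_real_rep θ
  have h1 := norm_unifChar_mul_sin_le M x
  have h2 := two_mul_abs_le_abs_sin hx2
  rw [← hx] at h
  have h3 : 3 ≤ M * |Real.sin (Real.pi * x)| := by
    have : (M : ℝ) * (2 * |x|) ≤ M * |Real.sin (Real.pi * x)| := by gcongr
    linarith
  nlinarith [norm_nonneg (unifChar M (x : UnitAddCircle))]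

lemma sum_sum_sub_sq (M : ℕ) :
    ∑ k : Fin M, ∑ l : Fin M, ((k : ℝ) - l) ^ 2 = (M : ℝ) ^ 2 * ((M : ℝ) ^ 2 - 1) / 6 := by
  have h1 : ∀ m : ℕ, ∑ k ∈ Finset.range m, (k : ℝ) = m * (m - 1) / 2 := by
    intro m
    induction m with
    | zero => simp
    | succ m ih => rw [Finset.sum_range_succ, ih]; push_cast; ring
  have h2 : ∀ m : ℕ, ∑ k ∈ Finset.range m, (k : ℝ) ^ 2 = m * (m - 1) * (2 * m - 1) / 6 := by
    intro m
    induction m with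
    | zero => simp
    | succ m ih => rw [Finset.sum_range_succ, ih]; push_cast; ring
  have h3 : ∀ k : ℝ, ∑ l : Fin M, (k - l) ^ 2 =
      M * k ^ 2 - 2 * k * (M * (M - 1) / 2) + M * (M - 1) * (2 * M - 1) / 6 := by
    intro k
    rw [← h1, ← h2, Fin.sum_univ_eq_sum_range (fun l => (k - l) ^ 2)]
    simp only [sub_sq, Finset.sum_add_distrib, Finset.sum_sub_distrib, Finset.sum_const,
      Finset.card_range, nsmul_eq_mul, Finset.mul_sum]
  simp only [h3]
  rw [Fin.sum_univ_eq_sum_range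
    (fun k => M * (k : ℝ) ^ 2 - 2 * k * (M * (M - 1) / 2) + M * (M - 1) * (2 * M - 1) / 6)]
  rw [Finset.sum_add_distrib, Finset.sum_sub_distrib, ← Finset.mul_sum, ← Finset.sum_mul,
    ← Finset.mul_sum, h1, h2]
  simp
  ring

lemma norm_unifChar_sq (M : ℕ) (x : ℝ) : ‖unifChar M (x : UnitAddCircle)‖ ^ 2 =
    ((M : ℝ) ^ 2)⁻¹ * ∑ k : Fin M, ∑ l : Fin M, Real.cos (2 * Real.pi * x * ((k : ℝ) - l)) := by
  have hf : ∀ k : Fin M, fourier ((k : ℤ) + 1) (x : UnitAddCircle) =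
      Complex.exp (((2 * Real.pi * x * (k + 1) : ℝ) : ℂ) * Complex.I) := by
    intro k
    rw [fourier_coe_apply]
    congr 1
    push_cast
    ring
  rw [unifChar, norm_mul, mul_pow, norm_inv, Complex.norm_natCast, inv_pow]
  congr 1
  rw [Finset.sum_congr rfl fun k _ => hf k, ← Complex.normSq_eq_norm_sq, Complex.normSq_apply]
  simp only [Complex.re_sum, Complex.im_sum, Complex.exp_ofReal_mul_I_re,
    Complex.exp_ofReal_mul_I_im, Finset.sum_mul_sum]
  rw [← Finset.sum_add_distrib]
  refine Finset.sum_congr rfl fun k _ => ?_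
  rw [← Finset.sum_add_distrib]
  refine Finset.sum_congr rfl fun l _ => ?_
  rw [← Real.cos_sub]
  congr 1
  ring

lemma norm_unifChar_le_of_le_half {M : ℕ} (hM : 2 ≤ M) {x : ℝ} (hx : M * |x| ≤ 1 / 2) :
    ‖unifChar M (x : UnitAddCircle)‖ ≤ 1 - M ^ 2 * x ^ 2 / 2 := by
  have hM' : (2 : ℝ) ≤ M := by exact_mod_cast hM
  have hc : ∀ k l : Fin M, Real.cos (2 * Real.pi * x * ((k : ℝ) - l)) ≤
      1 - 8 * x ^ 2 * ((k : ℝ) - l) ^ 2 := by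
    intro k l
    have hkl : |(k : ℝ) - l| ≤ M := by
      have h1 : (k : ℝ) ≤ M := by exact_mod_cast k.2.le
      have h2 : (l : ℝ) ≤ M := by exact_mod_cast l.2.le
      have h3 : (0 : ℝ) ≤ k := by positivity
      have h4 : (0 : ℝ) ≤ l := by positivity
      rw [abs_le]; constructor <;> linarith
    have hb : |2 * Real.pi * x * ((k : ℝ) - l)| ≤ Real.pi := by
      rw [abs_mul, abs_mul, abs_of_pos (by positivity : 0 < 2 * Real.pi)]
      calc 2 * Real.pi * |x| * |(k : ℝ) - l| ≤ 2 * Real.pi * |x| * M := by gcongr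
        _ = 2 * Real.pi * (M * |x|) := by ring
        _ ≤ 2 * Real.pi * (1 / 2) := by gcongr
        _ = Real.pi := by ring
    refine (Real.cos_le_one_sub_mul_cos_sq hb).trans (le_of_eq ?_)
    field_simp
    ring
  have hsq : ‖unifChar M (x : UnitAddCircle)‖ ^ 2 ≤ 1 - M ^ 2 * x ^ 2 := by
    rw [norm_unifChar_sq, inv_mul_le_iff₀ (by positivity)]
    calc _ ≤ ∑ k : Fin M, ∑ l : Fin M, (1 - 8 * x ^ 2 * ((k : ℝ) - l) ^ 2) :=
          Finset.sum_le_sum fun k _ => Finset.sum_le_sum fun l _ => hc k l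
      _ = (M : ℝ) ^ 2 - 8 * x ^ 2 * (∑ k : Fin M, ∑ l : Fin M, ((k : ℝ) - l) ^ 2) := by
          simp only [Finset.sum_sub_distrib, ← Finset.mul_sum]
          simp
          ring
      _ ≤ (M : ℝ) ^ 2 * (1 - M ^ 2 * x ^ 2) := by
          rw [sum_sum_sub_sq]
          have : 0 ≤ (M : ℝ) ^ 2 * x ^ 2 * ((M : ℝ) ^ 2 - 4) := by
            have : (0 : ℝ) ≤ (M : ℝ) ^ 2 - 4 := by nlinarith
            positivity
          linarith
  have hn := norm_nonneg (unifChar M (x : UnitAddCircle))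
  nlinarith [sq_nonneg (1 - ‖unifChar M (x : UnitAddCircle)‖)]

/-- On the scale `1 / M` the modulus of the characteristic function is at most `1` minus a multiple
of the square of the rescaled argument. -/
lemma exists_norm_unifChar_le_one_sub (K : ℝ) : ∃ c > 0, ∃ M₀ : ℕ, ∀ M ≥ M₀, ∀ x : ℝ,
    M * |x| ≤ K → ‖unifChar M (x : UnitAddCircle)‖ ≤ 1 - c * (M ^ 2 * x ^ 2) := by
  obtain ⟨M₀, hM₀⟩ := exists_nat_gt (4 * K + 2)
  refine ⟨min (1 / 2) (1 / (10 * (K ^ 2 + 1))), by positivity, M₀, fun M hM x hx => ?_⟩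
  have hMr : 4 * K + 2 < M := hM₀.trans_le (by exact_mod_cast hM)
  have hK : 0 ≤ K := le_trans (by positivity) hx
  have hM2 : (2 : ℝ) ≤ M := by linarith
  rcases le_or_gt (M * |x|) (1 / 2) with h | h
  · refine (norm_unifChar_le_of_le_half (by exact_mod_cast hM2) h).trans ?_
    have : min (1 / 2) (1 / (10 * (K ^ 2 + 1))) * ((M : ℝ) ^ 2 * x ^ 2) ≤
        1 / 2 * ((M : ℝ) ^ 2 * x ^ 2) := by
      gcongr
      exact min_le_left _ _
    linarith
  · have hx4 : |x| < 1 / 4 := by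
      by_contra hcon
      push Not at hcon
      nlinarith
    have hx0 : 0 < |x| := by
      by_contra hcon
      have : |x| = 0 := le_antisymm (not_lt.mp hcon) (abs_nonneg x)
      rw [this] at h
      norm_num at h
    have hs := Real.sin_gt_sub_cube (x := Real.pi * |x|) (by positivity)
    have hpi := Real.pi_gt_three
    have hpi2 := Real.pi_lt_d2
    have hs2 : 20 / 9 * |x| ≤ |Real.sin (Real.pi * x)| := by
      have h2 : |Real.sin (Real.pi * x)| = |Real.sin (Real.pi * |x|)| := by
        rcases abs_choice x with h | h <;> rw [h]
        rw [mul_neg, Real.sin_neg, abs_neg]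
      rw [h2]
      refine le_trans ?_ (le_abs_self _)
      refine le_trans ?_ hs.le
      have hy : (Real.pi * |x|) ^ 2 ≤ 0.63 := by
        have h0 : Real.pi * |x| ≤ 3.15 / 4 := by nlinarith
        nlinarith [mul_pos Real.pi_pos hx0]
      have : (Real.pi * |x|) ^ 3 = Real.pi * |x| * (Real.pi * |x|) ^ 2 := by ring
      rw [this]
      nlinarith [mul_pos Real.pi_pos hx0]
    have h1 := norm_unifChar_mul_sin_le M x
    have h3 : 10 / 9 ≤ M * |Real.sin (Real.pi * x)| := by
      have : (M : ℝ) * (20 / 9 * |x|) ≤ M * |Real.sin (Real.pi * x)| := by gcongr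
      linarith
    have h4 : ‖unifChar M (x : UnitAddCircle)‖ ≤ 9 / 10 := by
      nlinarith [norm_nonneg (unifChar M (x : UnitAddCircle))]
    refine h4.trans ?_
    have h5 : (M : ℝ) ^ 2 * x ^ 2 ≤ K ^ 2 := by
      rw [← sq_abs x, ← mul_pow]
      gcongr
    have h6 : min (1 / 2) (1 / (10 * (K ^ 2 + 1))) * ((M : ℝ) ^ 2 * x ^ 2) ≤
        1 / (10 * (K ^ 2 + 1)) * (K ^ 2 + 1) := by
      gcongr
      · exact min_le_right _ _
      · linarith
    have h7 : 1 / (10 * (K ^ 2 + 1)) * (K ^ 2 + 1) = 1 / 10 := by field_simp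
    linarith

end UniformCharacter

section PointwiseLimit

lemma norm_exp_mul_I_taylor_le {y : ℝ} (hy : |y| ≤ 1) :
    ‖Complex.exp (y * Complex.I) - 1 - y * Complex.I + (y : ℂ) ^ 2 / 2‖ ≤ |y| ^ 3 := by
  have hn : ‖(y : ℂ) * Complex.I‖ = |y| := by simp
  have h := Complex.exp_bound (x := y * Complex.I) (by rw [hn]; exact hy) (n := 3) (by norm_num)
  rw [hn] at h
  have he : Complex.exp (y * Complex.I) - 1 - y * Complex.I + (y : ℂ) ^ 2 / 2 =
      Complex.exp (y * Complex.I) -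
        ∑ m ∈ Finset.range 3, ((y : ℂ) * Complex.I) ^ m / (m.factorial : ℂ) := by
    simp only [Finset.sum_range_succ, Finset.sum_range_zero, mul_pow, Complex.I_sq]
    norm_num [Nat.factorial]
    ring
  rw [he]
  refine h.trans ?_
  have h3 : (0 : ℝ) ≤ |y| ^ 3 := by positivity
  norm_num [Nat.factorial] at h
  linarith

lemma sum_fin_succ_sq (m : ℕ) :
    ∑ k : Fin m, ((k : ℝ) + 1) ^ 2 = (m : ℝ) * (m + 1) * (2 * m + 1) / 6 := by
  rw [Fin.sum_univ_eq_sum_range (fun k => ((k : ℝ) + 1) ^ 2)]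
  induction m with
  | zero => simp
  | succ m ih => rw [Finset.sum_range_succ, ih]; push_cast; ring

lemma tendsto_second_moment {M : ℕ → ℕ} (hM : Tendsto M atTop atTop) :
    Tendsto (fun n => ((M n : ℝ) + 1) * (2 * M n + 1) / (6 * (M n : ℝ) ^ 2)) atTop
      (𝓝 (1 / 3)) := by
  have hinv : Tendsto (fun n => ((M n : ℝ))⁻¹) atTop (𝓝 0) :=
    tendsto_inv_atTop_zero.comp (tendsto_natCast_atTop_atTop.comp hM)
  have h : Tendsto (fun n => (1 + ((M n : ℝ))⁻¹) * (2 + ((M n : ℝ))⁻¹) / 6) atTop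
      (𝓝 ((1 + 0) * (2 + 0) / 6)) :=
    ((hinv.const_add 1).mul (hinv.const_add 2)).div_const 6
  norm_num at h
  refine (h.congr' ?_).trans (by norm_num)
  filter_upwards [hM.eventually_ge_atTop 1] with n hn
  have : (M n : ℝ) ≠ 0 := by positivity
  field_simp

/-- Second-order expansion of the characteristic function of the uniform distribution at scale
`1 / (M √n)`. -/
lemma tendsto_unifChar_expansion {M : ℕ → ℕ} (hM : Tendsto M atTop atTop) :
    ∃ L : ℕ → ℂ, ∀ v : ℝ, Tendsto (fun n : ℕ => (n : ℂ) *
      (unifChar (M n) ((v / (M n * √n) : ℝ) : UnitAddCircle) - 1 - L n * v)) atTop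
      (𝓝 ((-(2 * Real.pi ^ 2 / 3 * v ^ 2) : ℝ) : ℂ)) := by
  refine ⟨fun n => (M n : ℂ)⁻¹ * ∑ k : Fin (M n),
    ((2 * Real.pi * ((k : ℝ) + 1) / (M n * √n) : ℝ) : ℂ) * Complex.I, fun v => ?_⟩
  set y : (n : ℕ) → Fin (M n) → ℝ := fun n k => 2 * Real.pi * ((k : ℝ) + 1) * v / (M n * √n)
    with hy
  have hmain : Tendsto (fun n : ℕ => ((-(2 * Real.pi ^ 2 * v ^ 2 *
      (((M n : ℝ) + 1) * (2 * M n + 1) / (6 * (M n : ℝ) ^ 2))) : ℝ) : ℂ)) atTop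
      (𝓝 ((-(2 * Real.pi ^ 2 / 3 * v ^ 2) : ℝ) : ℂ)) := by
    refine (Complex.continuous_ofReal.tendsto _).comp ?_
    have := ((tendsto_second_moment hM).const_mul (2 * Real.pi ^ 2 * v ^ 2)).neg
    refine this.trans (le_of_eq ?_)
    congr 1
    ring
  have hsqrt : Tendsto (fun n : ℕ => √(n : ℝ)) atTop atTop :=
    Real.tendsto_sqrt_atTop.comp tendsto_natCast_atTop_atTop
  have herr : Tendsto (fun n : ℕ => (n : ℂ) * ((M n : ℂ)⁻¹ * ∑ k : Fin (M n),
      (Complex.exp (y n k * Complex.I) - 1 - y n k * Complex.I + (y n k : ℂ) ^ 2 / 2))) atTop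
      (𝓝 0) := by
    have hb : Tendsto (fun n : ℕ => (2 * Real.pi * |v|) ^ 3 / √n) atTop (𝓝 0) :=
      hsqrt.const_div_atTop _
    refine squeeze_zero_norm' ?_ hb
    filter_upwards [hM.eventually_ge_atTop 1, eventually_ge_atTop 1,
      hsqrt.eventually_ge_atTop (2 * Real.pi * |v|)] with n hMn hn hs
    have hM0 : (0 : ℝ) < M n := by exact_mod_cast hMn
    have hn0 : (0 : ℝ) < n := by exact_mod_cast hn
    have hs0 : 0 < √(n : ℝ) := Real.sqrt_pos.mpr hn0
    have hyb : ∀ k, |y n k| ≤ 2 * Real.pi * |v| / √n := by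
      intro k
      have hk : (k : ℝ) + 1 ≤ M n := by exact_mod_cast k.2
      rw [hy]
      simp only [abs_div, abs_mul, abs_of_pos hM0, abs_of_pos hs0, abs_of_pos Real.pi_pos, abs_two,
        abs_of_nonneg (by positivity : (0 : ℝ) ≤ (k : ℝ) + 1)]
      rw [div_le_div_iff₀ (by positivity) hs0]
      calc 2 * Real.pi * ((k : ℝ) + 1) * |v| * √n ≤ 2 * Real.pi * (M n) * |v| * √n := by gcongr
        _ = _ := by ring
    have hy1 : 2 * Real.pi * |v| / √n ≤ 1 := by rw [div_le_one hs0]; exact hs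
    rw [norm_mul, norm_mul, norm_inv, Complex.norm_natCast, Complex.norm_natCast]
    have hsum : ‖∑ k : Fin (M n), (Complex.exp (y n k * Complex.I) - 1 - y n k * Complex.I +
        (y n k : ℂ) ^ 2 / 2)‖ ≤ M n * (2 * Real.pi * |v| / √n) ^ 3 := by
      refine (norm_sum_le_of_le (n := fun _ => (2 * Real.pi * |v| / √n) ^ 3) _
        fun k _ => ?_).trans (le_of_eq ?_)
      · refine (norm_exp_mul_I_taylor_le ((hyb k).trans hy1)).trans ?_
        gcongr
        exact hyb k
      · simp
    calc _ ≤ (n : ℝ) * ((M n : ℝ)⁻¹ * (M n * (2 * Real.pi * |v| / √n) ^ 3)) := by gcongr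
      _ = n * ((2 * Real.pi * |v|) ^ 3 / √n ^ 3) := by
        rw [inv_mul_cancel_left₀ hM0.ne', div_pow]
      _ = _ := by
        nth_rw 1 [← Real.sq_sqrt hn0.le]
        field_simp
  have hsum := herr.add hmain
  rw [zero_add] at hsum
  refine hsum.congr' ?_
  filter_upwards [hM.eventually_ge_atTop 1, eventually_ge_atTop 1] with n hMn hn
  have hM0 : (M n : ℂ) ≠ 0 := by
    have : M n ≠ 0 := by omega
    exact_mod_cast this
  have hMr : (M n : ℝ) ≠ 0 := by
    have : M n ≠ 0 := by omega
    exact_mod_cast this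
  have hn0 : (0 : ℝ) < n := by exact_mod_cast hn
  have hs0 : √(n : ℝ) ≠ 0 := (Real.sqrt_pos.mpr hn0).ne'
  have hf : ∀ k : Fin (M n), fourier ((k : ℤ) + 1) ((v / (M n * √n) : ℝ) : UnitAddCircle) =
      Complex.exp (y n k * Complex.I) := by
    intro k
    rw [fourier_coe_apply, hy]
    congr 1
    push_cast
    ring
  have hy2 : (n : ℝ) * ((M n : ℝ)⁻¹ * ∑ k, (y n k) ^ 2 / 2) = 2 * Real.pi ^ 2 * v ^ 2 *
      (((M n : ℝ) + 1) * (2 * M n + 1) / (6 * (M n : ℝ) ^ 2)) := by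
    have : ∀ k, (y n k) ^ 2 / 2 =
        2 * Real.pi ^ 2 * v ^ 2 / ((M n) ^ 2 * √n ^ 2) * ((k : ℝ) + 1) ^ 2 := by
      intro k
      rw [hy]
      field_simp
    simp only [this]
    rw [← Finset.mul_sum, sum_fin_succ_sq, Real.sq_sqrt hn0.le]
    field_simp
  rw [← hy2]
  have hyL : ∑ k : Fin (M n), ((y n k : ℝ) : ℂ) * Complex.I = (∑ k : Fin (M n),
      ((2 * Real.pi * ((k : ℝ) + 1) / (M n * √n) : ℝ) : ℂ) * Complex.I) * v := by
    rw [Finset.sum_mul]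
    refine Finset.sum_congr rfl fun k _ => ?_
    rw [hy]
    push_cast
    ring
  rw [unifChar, Finset.sum_congr rfl fun k _ => hf k]
  simp only [Finset.sum_add_distrib, Finset.sum_sub_distrib, hyL]
  generalize (∑ k : Fin (M n),
    ((2 * Real.pi * ((k : ℝ) + 1) / (M n * √n) : ℝ) : ℂ) * Complex.I) = S
  generalize (∑ k : Fin (M n), Complex.exp (y n k * Complex.I)) = E
  push_cast
  simp only [Finset.sum_const, Finset.card_univ, Fintype.card_fin, nsmul_eq_mul, mul_one]
  field_simp
  ring

end PointwiseLimit

section StepCharacter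

variable {I J : Type*} [Fintype I] [Fintype J]

/-- The characteristic function of `x • A i` with `x` uniform on `{1, …, M}` and `i` uniform
on `I`. -/
noncomputable def stepChar (A : I → J → ℤ) (M : ℕ) (s : J → UnitAddCircle) : ℂ :=
  (Fintype.card I : ℂ)⁻¹ * ∑ i, unifChar M (∑ j, A i j • s j)

lemma continuous_stepChar (A : I → J → ℤ) (M : ℕ) : Continuous (stepChar A M) := by
  unfold stepChar
  refine continuous_const.mul (continuous_finsetSum _ fun i _ => ?_)
  exact (continuous_unifChar M).comp (by fun_prop)

lemma norm_stepChar_le (A : I → J → ℤ) (M : ℕ) (s : J → UnitAddCircle) :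
    ‖stepChar A M s‖ ≤ (Fintype.card I : ℝ)⁻¹ * ∑ i, ‖unifChar M (∑ j, A i j • s j)‖ := by
  rw [stepChar, norm_mul, norm_inv, Complex.norm_natCast]
  gcongr
  exact norm_sum_le _ _

lemma norm_stepChar_le_one (A : I → J → ℤ) (M : ℕ) (s : J → UnitAddCircle) :
    ‖stepChar A M s‖ ≤ 1 := by
  refine (norm_stepChar_le A M s).trans ?_
  calc _ ≤ (Fintype.card I : ℝ)⁻¹ * ∑ i : I, (1 : ℝ) := by
        gcongr; exact norm_unifChar_le_one _ _
    _ ≤ 1 := by simpa using inv_mul_le_one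

lemma sum_zsmul_coe (a : J → ℤ) (w : J → ℝ) :
    ∑ j, a j • ((w j : ℝ) : UnitAddCircle) = ((∑ j, a j * w j : ℝ) : UnitAddCircle) := by
  have h := map_sum (QuotientAddGroup.mk' (AddSubgroup.zmultiples (1 : ℝ)))
    (fun j => (a j : ℝ) * w j) Finset.univ
  refine Eq.trans ?_ h.symm
  refine Finset.sum_congr rfl fun j _ => ?_
  rw [← zsmul_eq_mul, map_zsmul]
  rfl

/-- The limiting quadratic form. -/
noncomputable def stepForm (A : I → J → ℤ) (w : J → ℝ) : ℝ :=
  2 * Real.pi ^ 2 / 3 * ((Fintype.card I : ℝ)⁻¹ * ∑ i, (∑ j, A i j * w j) ^ 2)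

lemma sum_sum_mul_eq_zero {A : I → J → ℤ} (hA : ∀ j, ∑ i, A i j = 0) (w : J → ℝ) :
    ∑ i, ∑ j, (A i j : ℝ) * w j = 0 := by
  rw [Finset.sum_comm]
  refine Finset.sum_eq_zero fun j _ => ?_
  rw [← Finset.sum_mul, ← Int.cast_sum, hA j]
  simp

lemma tendsto_stepChar_pow [Nonempty I] {M : ℕ → ℕ} (hM : Tendsto M atTop atTop)
    {A : I → J → ℤ} (hA : ∀ j, ∑ i, A i j = 0) (w : J → ℝ) :
    Tendsto (fun n : ℕ => stepChar A (M n) (fun j => ((w j / (M n * √n) : ℝ) : UnitAddCircle)) ^ n)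
      atTop (𝓝 ((Real.exp (-stepForm A w) : ℝ) : ℂ)) := by
  obtain ⟨L, hL⟩ := tendsto_unifChar_expansion hM
  set v : I → ℝ := fun i => ∑ j, A i j * w j with hv
  have hv0 : ∑ i, v i = 0 := sum_sum_mul_eq_zero hA w
  have hsum := (tendsto_finsetSum Finset.univ fun i _ => hL (v i)).const_mul
    ((Fintype.card I : ℂ)⁻¹)
  have hcard : (Fintype.card I : ℂ) ≠ 0 := by simp
  rw [Complex.ofReal_exp]
  have key : Tendsto (fun n : ℕ => (n : ℂ) * (stepChar A (M n)
      (fun j => ((w j / (M n * √n) : ℝ) : UnitAddCircle)) - 1)) atTop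
      (𝓝 ((-stepForm A w : ℝ) : ℂ)) := by
    refine (hsum.congr fun n => ?_).trans (le_of_eq ?_)
    · have hlin : ∀ i, ∑ j, A i j • ((w j / (M n * √n) : ℝ) : UnitAddCircle) =
          ((v i / (M n * √n) : ℝ) : UnitAddCircle) := by
        intro i
        rw [sum_zsmul_coe (A i) (fun j => w j / (M n * √n)), hv, Finset.sum_div]
        simp only [mul_div_assoc]
      have hv0' : ∑ i, (v i : ℂ) = 0 := by exact_mod_cast hv0
      simp only [stepChar, hlin]
      rw [← Finset.mul_sum]
      simp only [Finset.sum_sub_distrib, ← Finset.mul_sum, hv0']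
      simp only [Finset.sum_const, Finset.card_univ, nsmul_eq_mul, mul_one]
      field_simp
      ring
    · congr 1
      rw [stepForm, ← Complex.ofReal_sum, Finset.sum_neg_distrib, ← Finset.mul_sum, hv]
      push_cast
      ring
  refine (Complex.tendsto_one_add_pow_exp_of_tendsto key).congr fun n => ?_
  congr 1
  ring

end StepCharacter

section NearOrigin

/-- The box of radius `r` around the origin of the torus. -/
def torusBox (J : Type*) (r : ℝ) : Set (J → UnitAddCircle) := {s | ∀ j, ‖s j‖ ≤ r}

lemma isClosed_torusBox {J : Type*} (r : ℝ) : IsClosed (torusBox J r) := by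
  have : torusBox J r = ⋂ j, {s | ‖s j‖ ≤ r} := by
    ext s
    simp [torusBox]
  rw [this]
  exact isClosed_iInter fun j => isClosed_le (by fun_prop) continuous_const

lemma measurableSet_abs_le {J : Type*} [Countable J] (r : ℝ) :
    MeasurableSet {u : J → ℝ | ∀ j, |u j| ≤ r} := by
  have : {u : J → ℝ | ∀ j, |u j| ≤ r} = ⋂ j, {u | |u j| ≤ r} := by
    ext s
    simp
  rw [this]
  exact (isClosed_iInter fun j => isClosed_le (by fun_prop) continuous_const).measurableSet

variable {I J : Type*} [Fintype I] [Fintype J]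

lemma measurePreserving_coe_torus : MeasurePreserving
    (fun (u : J → ℝ) j => (u j : UnitAddCircle))
    (volume.restrict (Set.univ.pi fun _ => Set.Ioc (-1 / 2 : ℝ) (-1 / 2 + 1))) volume := by
  rw [volume_pi, Measure.restrict_pi_pi, volume_pi]
  exact measurePreserving_pi _ _ fun _ => UnitAddCircle.measurePreserving_mk _

lemma setIntegral_torusBox {f : (J → UnitAddCircle) → ℝ} (hf : Continuous f) {r : ℝ}
    (hr : r < 1 / 2) :
    ∫ s in torusBox J r, f s =
      ∫ u : J → ℝ in {u | ∀ j, |u j| ≤ r}, f (fun j => (u j : UnitAddCircle)) := by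
  have hbox : MeasurableSet (torusBox J r) := (isClosed_torusBox r).measurableSet
  have hbox' : MeasurableSet {u : J → ℝ | ∀ j, |u j| ≤ r} := measurableSet_abs_le _
  rw [← integral_indicator hbox, ← integral_indicator hbox',
    ← (measurePreserving_coe_torus (J := J)).map_eq, integral_map
      (measurePreserving_coe_torus (J := J)).measurable.aemeasurable
      ((hf.measurable.indicator hbox).aestronglyMeasurable),
    ← integral_indicator (MeasurableSet.univ_pi fun _ => measurableSet_Ioc)]
  congr 1
  ext u
  by_cases hu : ∀ j, |u j| ≤ r
  · have hmem : u ∈ Set.univ.pi fun _ : J => Set.Ioc (-1 / 2 : ℝ) (-1 / 2 + 1) := by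
      intro j _
      have := abs_le.mp (hu j)
      constructor <;> linarith
    have hmem' : (fun j => (u j : UnitAddCircle)) ∈ torusBox J r := by
      intro j
      have : ‖(u j : UnitAddCircle)‖ = |u j| := by
        rw [AddCircle.norm_coe_eq_abs_iff _ one_ne_zero]
        have := hu j
        norm_num
        linarith
      simp only [this]
      exact hu j
    rw [Set.indicator_of_mem hmem, Set.indicator_of_mem hmem',
      Set.indicator_of_mem (show u ∈ {u : J → ℝ | ∀ j, |u j| ≤ r} from hu)]
  · rw [Set.indicator_of_notMem (show u ∉ {u : J → ℝ | ∀ j, |u j| ≤ r} from hu)]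
    by_cases hmem : u ∈ Set.univ.pi fun _ : J => Set.Ioc (-1 / 2 : ℝ) (-1 / 2 + 1)
    · rw [Set.indicator_of_mem hmem, Set.indicator_of_notMem]
      intro hcon
      refine hu fun j => ?_
      have hj := hmem j trivial
      have hn : ‖(u j : UnitAddCircle)‖ = |u j| := by
        rw [AddCircle.norm_coe_eq_abs_iff _ one_ne_zero, abs_one, abs_le]
        constructor <;> linarith [hj.1, hj.2]
      rw [← hn]
      exact hcon j
    · rw [Set.indicator_of_notMem hmem]

lemma integrable_exp_neg_mul_sum_sq {b : ℝ} (hb : 0 < b) :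
    Integrable (fun w : J → ℝ => Real.exp (-b * ∑ j, w j ^ 2)) := by
  have h := Integrable.fintype_prod (ι := J) (μ := fun _ => (volume : Measure ℝ))
    (f := fun _ x => Real.exp (-b * x ^ 2)) fun _ => integrable_exp_neg_mul_sq hb
  refine h.congr (Eventually.of_forall fun w => ?_)
  simp only
  rw [← Real.exp_sum, Finset.mul_sum]

/-- A Gaussian bound for powers of the step characteristic function near the origin. -/
lemma exists_norm_stepChar_pow_le [Nonempty I] {A : I → J → ℤ}
    (hAp : ∀ w : J → ℝ, ∑ j, w j ^ 2 ≤ ∑ i, (∑ j, A i j * w j) ^ 2) {C : ℝ} (hC : 0 < C) :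
    ∃ b > 0, ∃ M₀ : ℕ, ∀ M ≥ M₀, 1 ≤ M → ∀ n : ℕ, 1 ≤ n → ∀ w : J → ℝ,
      (∀ j, |w j| ≤ C * √n) →
      ‖stepChar A M (fun j => ((w j / (M * √n) : ℝ) : UnitAddCircle)) ^ n‖ ≤
        Real.exp (-b * ∑ j, w j ^ 2) := by
  obtain ⟨c, hc, M₀, hM₀⟩ := exists_norm_unifChar_le_one_sub (C * ∑ i, ∑ j, |(A i j : ℝ)|)
  have hcard : (0 : ℝ) < Fintype.card I := by exact_mod_cast Fintype.card_pos
  refine ⟨c / Fintype.card I, by positivity, M₀, fun M hM hM1 n hn w hw => ?_⟩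
  have hM0 : (0 : ℝ) < M := by exact_mod_cast hM1
  have hn0 : (0 : ℝ) < n := by exact_mod_cast hn
  have hs0 : 0 < √(n : ℝ) := Real.sqrt_pos.mpr hn0
  set v : I → ℝ := fun i => ∑ j, A i j * w j with hv
  have hlin : ∀ i, ∑ j, A i j • ((w j / (M * √n) : ℝ) : UnitAddCircle) =
      ((v i / (M * √n) : ℝ) : UnitAddCircle) := by
    intro i
    rw [sum_zsmul_coe (A i) (fun j => w j / (M * √n)), hv, Finset.sum_div]
    simp only [mul_div_assoc]
  have hvb : ∀ i, |v i| ≤ (C * ∑ i, ∑ j, |(A i j : ℝ)|) * √n := by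
    intro i
    calc |v i| ≤ ∑ j, |(A i j : ℝ)| * (C * √n) := by
          refine (Finset.abs_sum_le_sum_abs _ _).trans (Finset.sum_le_sum fun j _ => ?_)
          rw [abs_mul]
          gcongr
          exact hw j
      _ = (∑ j, |(A i j : ℝ)|) * (C * √n) := by rw [Finset.sum_mul]
      _ ≤ (∑ i, ∑ j, |(A i j : ℝ)|) * (C * √n) := by
          gcongr
          exact Finset.single_le_sum (f := fun i => ∑ j, |(A i j : ℝ)|)
            (fun i _ => Finset.sum_nonneg fun j _ => abs_nonneg _) (Finset.mem_univ i)
      _ = _ := by ring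
  have hu : ∀ i, ‖unifChar M ((v i / (M * √n) : ℝ) : UnitAddCircle)‖ ≤
      1 - c / n * v i ^ 2 := by
    intro i
    refine (hM₀ M hM _ ?_).trans (le_of_eq ?_)
    · rw [abs_div, abs_of_pos (by positivity : 0 < (M : ℝ) * √n)]
      rw [← mul_div_assoc, mul_div_mul_left _ _ hM0.ne', div_le_iff₀ hs0]
      exact hvb i
    · rw [div_pow, mul_pow, Real.sq_sqrt hn0.le]
      field_simp
  have hle : ‖stepChar A M (fun j => ((w j / (M * √n) : ℝ) : UnitAddCircle))‖ ≤
      1 - c / Fintype.card I * (∑ j, w j ^ 2) / n := by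
    refine (norm_stepChar_le _ _ _).trans ?_
    simp only [hlin]
    calc _ ≤ (Fintype.card I : ℝ)⁻¹ * ∑ i, (1 - c / n * v i ^ 2) := by
          gcongr with i
          exact hu i
      _ = 1 - c / Fintype.card I * (∑ i, v i ^ 2) / n := by
          rw [Finset.sum_sub_distrib, ← Finset.mul_sum]
          simp only [Finset.sum_const, Finset.card_univ, nsmul_eq_mul, mul_one]
          field_simp
      _ ≤ _ := by
          gcongr
          exact hAp w
  rw [norm_pow]
  calc _ ≤ (Real.exp (-(c / Fintype.card I * (∑ j, w j ^ 2) / n))) ^ n := by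
        gcongr
        refine hle.trans ?_
        have := Real.add_one_le_exp (-(c / Fintype.card I * (∑ j, w j ^ 2) / n))
        linarith
    _ = _ := by
        rw [← Real.exp_nat_mul]
        congr 1
        field_simp

/-- The rescaled integral of powers of the step characteristic function over a box of size `1 / M`
converges to a Gaussian integral. -/
lemma tendsto_setIntegral_stepChar_pow [Nonempty I] {M : ℕ → ℕ} (hM : Tendsto M atTop atTop)
    {A : I → J → ℤ} (hA : ∀ j, ∑ i, A i j = 0)
    (hAp : ∀ w : J → ℝ, ∑ j, w j ^ 2 ≤ ∑ i, (∑ j, A i j * w j) ^ 2) {C : ℝ} (hC : 0 < C)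
    {g : ℂ → ℝ} (hg : Continuous g) (hgn : ∀ z, |g z| ≤ ‖z‖) (hgr : ∀ x : ℝ, 0 ≤ x → g x = x) :
    Tendsto (fun n : ℕ => (M n * √n) ^ Fintype.card J *
      ∫ s in torusBox J (C / M n), g (stepChar A (M n) s ^ n)) atTop
      (𝓝 (∫ w : J → ℝ, Real.exp (-stepForm A w))) := by
  obtain ⟨b, hb, M₀, hbM⟩ := exists_norm_stepChar_pow_le hAp hC
  set F : ℕ → (J → ℝ) → ℝ := fun n w => {w : J → ℝ | ∀ j, |w j| ≤ C * √n}.indicator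
    (fun w => g (stepChar A (M n) (fun j => ((w j / (M n * √n) : ℝ) : UnitAddCircle)) ^ n)) w
    with hF
  have hlim : Tendsto (fun n => ∫ w, F n w) atTop
      (𝓝 (∫ w : J → ℝ, Real.exp (-stepForm A w))) := by
    refine tendsto_integral_filter_of_dominated_convergence
      (fun w : J → ℝ => Real.exp (-b * ∑ j, w j ^ 2)) ?_ ?_ (integrable_exp_neg_mul_sum_sq hb) ?_
    · refine Eventually.of_forall fun n => ?_
      have hms : MeasurableSet {w : J → ℝ | ∀ j, |w j| ≤ C * √n} := measurableSet_abs_le _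
      have hcont : Continuous (fun w : J → ℝ =>
          g (stepChar A (M n) (fun j => ((w j / (M n * √n) : ℝ) : UnitAddCircle)) ^ n)) := by
        refine hg.comp (((continuous_stepChar A (M n)).comp ?_).pow n)
        refine continuous_pi fun j => ?_
        exact (AddCircle.continuous_mk' 1).comp (by fun_prop)
      exact (hcont.measurable.indicator hms).aestronglyMeasurable
    · filter_upwards [hM.eventually_ge_atTop M₀, hM.eventually_ge_atTop 1,
        eventually_ge_atTop 1] with n h1 h2 h3
      refine Eventually.of_forall fun w => ?_
      by_cases hw : w ∈ {w : J → ℝ | ∀ j, |w j| ≤ C * √n}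
      · simp only [hF]
        rw [Set.indicator_of_mem hw]
        exact (hgn _).trans (hbM (M n) h1 h2 n h3 w hw)
      · simp only [hF]
        rw [Set.indicator_of_notMem hw, norm_zero]
        positivity
    · refine Eventually.of_forall fun w => ?_
      have h1 := (hg.tendsto _).comp (tendsto_stepChar_pow hM hA w)
      rw [hgr _ (Real.exp_pos _).le] at h1
      refine h1.congr' ?_
      have hsqrt : Tendsto (fun n : ℕ => C * √(n : ℝ)) atTop atTop :=
        (Real.tendsto_sqrt_atTop.comp tendsto_natCast_atTop_atTop).const_mul_atTop hC
      have hall : ∀ᶠ n : ℕ in atTop, ∀ j, |w j| ≤ C * √n :=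
        eventually_all.mpr fun j => hsqrt.eventually_ge_atTop _
      filter_upwards [hall] with n hn
      simp only [hF]
      rw [Set.indicator_of_mem (show w ∈ {w : J → ℝ | ∀ j, |w j| ≤ C * √n} from hn)]
      rfl
  refine hlim.congr' ?_
  have hMr : Tendsto (fun n => (M n : ℝ)) atTop atTop := tendsto_natCast_atTop_atTop.comp hM
  filter_upwards [hMr.eventually_gt_atTop (2 * C), hM.eventually_ge_atTop 1,
    eventually_ge_atTop 1] with n h1 h2 h3
  have hM0 : (0 : ℝ) < M n := by exact_mod_cast h2
  have hn0 : (0 : ℝ) < n := by exact_mod_cast h3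
  have hs0 : 0 < √(n : ℝ) := Real.sqrt_pos.mpr hn0
  have hN : 0 < (M n : ℝ) * √n := by positivity
  rw [setIntegral_torusBox (f := fun s => g (stepChar A (M n) s ^ n))
    (hg.comp ((continuous_stepChar A (M n)).pow n))
    (by rw [div_lt_iff₀ hM0]; linarith)]
  have hbox' : MeasurableSet {u : J → ℝ | ∀ j, |u j| ≤ C / M n} := measurableSet_abs_le _
  rw [← integral_indicator hbox']
  have hsc := Measure.integral_comp_smul (volume : Measure (J → ℝ))
    ({u : J → ℝ | ∀ j, |u j| ≤ C / M n}.indicator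
      (fun u => g (stepChar A (M n) (fun j => (u j : UnitAddCircle)) ^ n))) ((M n * √n)⁻¹)
  rw [Module.finrank_fintype_fun_eq_card, inv_pow, inv_inv, abs_of_pos (by positivity),
    smul_eq_mul] at hsc
  rw [← hsc]
  congr 1
  ext w
  have hiff : ((M n * √n)⁻¹ • w ∈ {u : J → ℝ | ∀ j, |u j| ≤ C / M n}) ↔
      w ∈ {w : J → ℝ | ∀ j, |w j| ≤ C * √n} := by
    simp only [Set.mem_ofPred_eq, Pi.smul_apply, smul_eq_mul]
    refine forall_congr' fun j => ?_
    rw [abs_mul, abs_inv, abs_of_pos hN, inv_mul_le_iff₀ hN,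
      show (M n : ℝ) * √n * (C / M n) = C * √n by field_simp]
  have hpt : (fun j => ((((M n * √n)⁻¹ • w) j : ℝ) : UnitAddCircle)) =
      fun j => ((w j / (M n * √n) : ℝ) : UnitAddCircle) := by
    ext j
    rw [Pi.smul_apply, smul_eq_mul, div_eq_inv_mul]
  simp only [hF]
  by_cases hw : w ∈ {w : J → ℝ | ∀ j, |w j| ≤ C * √n}
  · rw [Set.indicator_of_mem hw, Set.indicator_of_mem (hiff.mpr hw), hpt]
  · rw [Set.indicator_of_notMem hw, Set.indicator_of_notMem (mt hiff.mp hw)]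

end NearOrigin

section Counting

lemma fourier_sum_apply {ι : Type*} (S : Finset ι) (k : ℤ) (f : ι → UnitAddCircle) :
    fourier k (∑ i ∈ S, f i) = ∏ i ∈ S, fourier k (f i) := by
  classical
  induction S using Finset.induction_on with
  | empty => simp
  | insert a S ha ih =>
    rw [Finset.sum_insert ha, Finset.prod_insert ha, ← ih]
    simp only [fourier_apply, smul_add, AddCircle.toCircle_add, Circle.coe_mul]

lemma fourier_zsmul_apply (k a : ℤ) (θ : UnitAddCircle) :
    fourier k (a • θ) = fourier (k * a) θ := by
  rw [fourier_apply, fourier_apply, smul_smul]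

lemma prod_fourier_apply {ι : Type*} (S : Finset ι) (k : ι → ℤ) (θ : UnitAddCircle) :
    ∏ i ∈ S, fourier (k i) θ = fourier (∑ i ∈ S, k i) θ := by
  classical
  induction S using Finset.induction_on with
  | empty => simp
  | insert a S ha ih => rw [Finset.sum_insert ha, Finset.prod_insert ha, ih, fourier_add]

lemma integral_fourier_unitAddCircle (k : ℤ) :
    ∫ θ : UnitAddCircle, fourier k θ = if k = 0 then 1 else 0 := by
  have h := congrFun (fourierCoeff_fourier (T := 1) k) 0
  rw [fourierCoeff, AddCircle.integral_haarAddCircle] at h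
  simp only [inv_one, one_smul, neg_zero, fourier_zero] at h
  rw [h, Pi.single_apply]
  simp only [eq_comm]

/-- The number of choices `σ` for which the weighted sum of the steps `A (σ m)` vanishes. -/
noncomputable def zeroSumCount {I J : Type*} (A : I → J → ℤ) (n : ℕ) (X : Fin n → ℕ) : ℕ :=
  Set.ncard {σ : Fin n → I | ∀ j, ∑ m, (X m : ℤ) * A (σ m) j = 0}

variable {I J : Type*} [Fintype I] [Fintype J]

lemma stepChar_pow_eq_sum (A : I → J → ℤ) (M n : ℕ) (s : J → UnitAddCircle) :
    stepChar A M s ^ n = ((M : ℂ) ^ n * (Fintype.card I : ℂ) ^ n)⁻¹ *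
      ∑ X : Fin n → Fin M, ∑ σ : Fin n → I,
        ∏ j, fourier (∑ m, (((X m : ℕ) + 1 : ℕ) : ℤ) * A (σ m) j) (s j) := by
  have h1 : stepChar A M s = ((M : ℂ) * (Fintype.card I : ℂ))⁻¹ *
      ∑ p : Fin M × I, ∏ j, fourier ((((p.1 : ℕ) + 1 : ℕ) : ℤ) * A p.2 j) (s j) := by
    rw [stepChar, Fintype.sum_prod_type_right]
    simp only [unifChar, ← Finset.mul_sum]
    rw [← mul_assoc, mul_inv, mul_comm (M : ℂ)⁻¹]
    congr 1
    refine Finset.sum_congr rfl fun i _ => Finset.sum_congr rfl fun x _ => ?_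
    rw [fourier_sum_apply]
    refine Finset.prod_congr rfl fun j _ => ?_
    rw [fourier_zsmul_apply]
    push_cast
    rfl
  rw [h1, mul_pow, inv_pow, mul_pow, Fintype.sum_pow,
    ← (Equiv.arrowProdEquivProdArrow (Fin n) (fun _ => Fin M) (fun _ => I)).symm.sum_comp,
    Fintype.sum_prod_type]
  congr 1
  refine Finset.sum_congr rfl fun X _ => Finset.sum_congr rfl fun σ _ => ?_
  rw [Finset.prod_comm]
  refine Finset.prod_congr rfl fun j _ => ?_
  rw [prod_fourier_apply]
  rfl

lemma integrable_stepChar_pow (A : I → J → ℤ) (M n : ℕ) :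
    Integrable (fun s => stepChar A M s ^ n) :=
  Integrable.of_bound ((continuous_stepChar A M).pow n).aestronglyMeasurable 1
    (Eventually.of_forall fun s => by
      rw [norm_pow]
      exact pow_le_one₀ (norm_nonneg _) (norm_stepChar_le_one A M s))

/-- Fourier inversion: the probability of a vanishing sum of steps. -/
lemma integral_stepChar_pow (A : I → J → ℤ) (M n : ℕ) :
    ∫ s, stepChar A M s ^ n = ((M : ℂ) ^ n * (Fintype.card I : ℂ) ^ n)⁻¹ *
      ∑ X : Fin n → Fin M, (zeroSumCount A n (fun m => (X m : ℕ) + 1) : ℂ) := by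
  classical
  have hint : ∀ k : J → ℤ, Integrable (fun s : J → UnitAddCircle => ∏ j, fourier (k j) (s j)) := by
    intro k
    refine Integrable.of_bound (C := 1) (Continuous.aestronglyMeasurable (by fun_prop))
      (Eventually.of_forall fun s => ?_)
    rw [norm_prod]
    simp only [norm_fourier_apply, Finset.prod_const_one, le_refl]
  simp only [stepChar_pow_eq_sum]
  rw [integral_const_mul, integral_finsetSum _ fun X _ => integrable_finsetSum _ fun σ _ => hint _]
  congr 1
  refine Finset.sum_congr rfl fun X _ => ?_
  rw [integral_finsetSum _ fun σ _ => hint _, zeroSumCount, Set.ncard_eq_toFinset_card']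
  rw [Set.toFinset_ofPred, Finset.card_filter]
  push_cast
  refine Finset.sum_congr rfl fun σ _ => ?_
  rw [volume_pi, integral_fintype_prod_eq_prod]
  simp only [integral_fourier_unitAddCircle]
  by_cases h : ∀ j, ∑ m, (((X m : ℕ) : ℤ) + 1) * A (σ m) j = 0
  · simp [h]
  · rw [if_neg h]
    push Not at h
    obtain ⟨j, hj⟩ := h
    exact Finset.prod_eq_zero (Finset.mem_univ j) (if_neg hj)

lemma integral_re_stepChar_pow (A : I → J → ℤ) (M n : ℕ) :
    ∫ s, (stepChar A M s ^ n).re = ((M : ℝ) ^ n * (Fintype.card I : ℝ) ^ n)⁻¹ *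
      ∑ X : Fin n → Fin M, (zeroSumCount A n (fun m => (X m : ℕ) + 1) : ℝ) := by
  have h := Complex.reCLM.integral_comp_comm (integrable_stepChar_pow A M n)
  simp only [Complex.reCLM_apply] at h
  rw [h, integral_stepChar_pow]
  rw [← Complex.ofReal_re (((M : ℝ) ^ n * (Fintype.card I : ℝ) ^ n)⁻¹ *
      ∑ X : Fin n → Fin M, (zeroSumCount A n (fun m => (X m : ℕ) + 1) : ℝ))]
  push_cast
  rfl

end Counting

section PairsAndBalance

/-- Two copies of a step system, chosen independently. -/
def pairStep {I J : Type*} (A : I → J → ℤ) : I × I → J ⊕ J → ℤ := fun p => Sum.elim (A p.1) (A p.2)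

lemma zeroSumCount_pairStep {I J : Type*} (A : I → J → ℤ) (n : ℕ) (X : Fin n → ℕ) :
    zeroSumCount (pairStep A) n X = zeroSumCount A n X ^ 2 := by
  rw [zeroSumCount, zeroSumCount, sq, ← Set.ncard_prod,
    ← Set.ncard_image_of_injective _
      (Equiv.arrowProdEquivProdArrow (Fin n) (fun _ => I) (fun _ => I)).injective]
  congr 1
  ext ⟨σ, τ⟩
  rw [Equiv.image_eq_preimage_symm]
  simp [pairStep, Equiv.arrowProdEquivProdArrow]

lemma sum_pairStep {I J : Type*} [Fintype I] {A : I → J → ℤ} (hA : ∀ j, ∑ i, A i j = 0) (j : J ⊕ J) :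
    ∑ p, pairStep A p j = 0 := by
  rcases j with j | j
  · rw [Fintype.sum_prod_type_right]
    simp [pairStep, hA]
  · rw [Fintype.sum_prod_type]
    simp [pairStep, hA]

variable {I J : Type*} [Fintype I] [Fintype J]

lemma sum_sq_pairStep {A : I → J → ℤ} (hA : ∀ j, ∑ i, A i j = 0) (w : J ⊕ J → ℝ) :
    ∑ p, (∑ j, pairStep A p j * w j) ^ 2 = Fintype.card I *
      (∑ i, (∑ j, A i j * w (Sum.inl j)) ^ 2 + ∑ i, (∑ j, A i j * w (Sum.inr j)) ^ 2) := by
  have h1 := sum_sum_mul_eq_zero hA (fun j => w (Sum.inl j))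
  set a : I → ℝ := fun i => ∑ j, A i j * w (Sum.inl j) with ha
  set b : I → ℝ := fun i => ∑ j, A i j * w (Sum.inr j) with hb
  have h : ∀ p : I × I, ∑ j, pairStep A p j * w j = a p.1 + b p.2 := by
    intro p
    simp [pairStep, ha, hb]
  change _ = Fintype.card I * (∑ i, a i ^ 2 + ∑ i, b i ^ 2)
  simp only [h]
  rw [Fintype.sum_prod_type_right]
  simp only [add_sq, Finset.sum_add_distrib, ← Finset.sum_mul, ← Finset.mul_sum]
  rw [h1]
  simp only [Finset.sum_const, Finset.card_univ, nsmul_eq_mul, mul_zero, zero_mul,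
    ← Finset.mul_sum]
  ring

lemma stepForm_pairStep {A : I → J → ℤ} (hA : ∀ j, ∑ i, A i j = 0) (w : J ⊕ J → ℝ) :
    stepForm (pairStep A) w =
      stepForm A (fun j => w (Sum.inl j)) + stepForm A (fun j => w (Sum.inr j)) := by
  simp only [stepForm]
  rw [sum_sq_pairStep hA, Fintype.card_prod]
  rcases Nat.eq_zero_or_pos (Fintype.card I) with h | h
  · simp [h]
  · push_cast
    field_simp

lemma integral_exp_neg_stepForm_pairStep {A : I → J → ℤ} (hA : ∀ j, ∑ i, A i j = 0) :
    ∫ w : J ⊕ J → ℝ, Real.exp (-stepForm (pairStep A) w) =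
      (∫ w : J → ℝ, Real.exp (-stepForm A w)) ^ 2 := by
  rw [sq, ← integral_prod_mul (μ := (volume : Measure (J → ℝ))) (ν := (volume : Measure (J → ℝ)))]
  have h := (volume_measurePreserving_sumPiEquivProdPi (fun _ : J ⊕ J => ℝ)).integral_comp'
    (fun z : (J → ℝ) × (J → ℝ) => Real.exp (-stepForm A z.1) * Real.exp (-stepForm A z.2))
  refine Eq.trans ?_ h
  congr 1
  ext w
  rw [stepForm_pairStep hA, neg_add, Real.exp_add]
  rfl

lemma le_sum_sq_pairStep {A : I → J → ℤ} [Nonempty I] (hA : ∀ j, ∑ i, A i j = 0)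
    (hAp : ∀ w : J → ℝ, ∑ j, w j ^ 2 ≤ ∑ i, (∑ j, A i j * w j) ^ 2) (w : J ⊕ J → ℝ) :
    ∑ j, w j ^ 2 ≤ ∑ p, (∑ j, pairStep A p j * w j) ^ 2 := by
  rw [sum_sq_pairStep hA, Fintype.sum_sum_type]
  have hcard : (1 : ℝ) ≤ Fintype.card I := by exact_mod_cast Fintype.card_pos
  have h1 := hAp fun j => w (Sum.inl j)
  have h2 := hAp fun j => w (Sum.inr j)
  have h3 : 0 ≤ ∑ i, (∑ j, A i j * w (Sum.inl j)) ^ 2 + ∑ i, (∑ j, A i j * w (Sum.inr j)) ^ 2 := by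
    positivity
  nlinarith

lemma integral_exp_neg_stepForm_pos {A : I → J → ℤ} [Nonempty I]
    (hAp : ∀ w : J → ℝ, ∑ j, w j ^ 2 ≤ ∑ i, (∑ j, A i j * w j) ^ 2) :
    0 < ∫ w : J → ℝ, Real.exp (-stepForm A w) := by
  have hcard : (0 : ℝ) < Fintype.card I := by exact_mod_cast Fintype.card_pos
  refine integral_exp_pos ?_
  refine (integrable_exp_neg_mul_sum_sq (J := J)
    (b := 2 * Real.pi ^ 2 / 3 * (Fintype.card I : ℝ)⁻¹) (by positivity)).mono' ?_ ?_
  · refine Continuous.aestronglyMeasurable ?_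
    unfold stepForm
    fun_prop
  · refine Eventually.of_forall fun w => ?_
    rw [Real.norm_eq_abs, abs_of_pos (Real.exp_pos _), Real.exp_le_exp, stepForm, neg_mul,
      neg_le_neg_iff, mul_assoc]
    gcongr
    exact hAp w

/-- The step `e_i` in `ℤ^(d+1) / (1, …, 1)`, in the coordinates `S_(j+1) - S_0`. -/
def balanceStep (d : ℕ) : Fin (d + 1) → Fin d → ℤ := fun i j =>
  (if i = j.succ then 1 else 0) - if i = 0 then 1 else 0

lemma sum_balanceStep (d : ℕ) (j : Fin d) : ∑ i, balanceStep d i j = 0 := by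
  simp [balanceStep, Finset.sum_sub_distrib]

lemma balanceStep_succ (d : ℕ) (i j : Fin d) :
    balanceStep d i.succ j = if i = j then 1 else 0 := by
  simp [balanceStep, Fin.succ_ne_zero]

lemma balanceStep_zero (d : ℕ) (j : Fin d) : balanceStep d 0 j = -1 := by
  simp [balanceStep, (Fin.succ_ne_zero _).symm]

lemma le_sum_sq_balanceStep (d : ℕ) (w : Fin d → ℝ) :
    ∑ j, w j ^ 2 ≤ ∑ i, (∑ j, balanceStep d i j * w j) ^ 2 := by
  rw [Fin.sum_univ_succ]
  simp only [balanceStep_succ]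
  simp only [Int.cast_ite, Int.cast_one, Int.cast_zero, ite_mul, one_mul, zero_mul,
    Finset.sum_ite_eq, Finset.mem_univ, if_true]
  exact le_add_of_nonneg_left (sq_nonneg _)

lemma perfectCount_eq_zeroSumCount {d n : ℕ} (hn : 1 ≤ n) (X : Fin n → ℕ)
    (hX : ∀ m, 0 < X m) : perfectCount (d + 1) n X = zeroSumCount (balanceStep d) n X := by
  rw [perfectCount, zeroSumCount]
  congr 1
  ext σ
  simp only [Set.mem_ofPred_eq]
  have hsum : ∀ j : Fin d, ∑ m, (X m : ℤ) * balanceStep d (σ m) j =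
      ((∑ m ∈ Finset.univ.filter fun m => σ m = j.succ, X m : ℕ) : ℤ) -
        ((∑ m ∈ Finset.univ.filter fun m => σ m = 0, X m : ℕ) : ℤ) := by
    intro j
    simp only [balanceStep, mul_sub, Finset.sum_sub_distrib, mul_ite, mul_one, mul_zero,
      Nat.cast_sum, Finset.sum_filter, Nat.cast_ite, Nat.cast_zero]
  simp only [hsum, sub_eq_zero, Nat.cast_inj]
  constructor
  · rintro ⟨-, h⟩ j
    exact h _ _
  · intro h
    have h0 : ∀ α, ∑ m ∈ Finset.univ.filter (fun m => σ m = α), X m =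
        ∑ m ∈ Finset.univ.filter (fun m => σ m = 0), X m := by
      intro α
      refine Fin.cases rfl h α
    refine ⟨fun α => ?_, fun α β => (h0 α).trans (h0 β).symm⟩
    have hpos : 0 < ∑ m ∈ Finset.univ.filter (fun m => σ m = σ ⟨0, hn⟩), X m :=
      Finset.sum_pos (fun m _ => hX m) ⟨⟨0, hn⟩, by simp⟩
    rw [h0, ← h0 α] at hpos
    obtain ⟨m, hm, -⟩ := Finset.exists_ne_zero_of_sum_ne_zero hpos.ne'
    exact ⟨m, (Finset.mem_filter.mp hm).2⟩

end PairsAndBalance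

section FarRegion

lemma norm_stepChar_le_one_sub {I J : Type*} [Fintype I] [Fintype J] [Nonempty I]
    (A : I → J → ℤ) (M : ℕ) (s : J → UnitAddCircle) (B : Finset I)
    (hB : ∀ i ∈ B, 3 / 2 ≤ M * ‖∑ j, A i j • s j‖) :
    ‖stepChar A M s‖ ≤ 1 - 2 / 3 * B.card / Fintype.card I := by
  classical
  have hcard : (0 : ℝ) < Fintype.card I := by exact_mod_cast Fintype.card_pos
  refine (norm_stepChar_le A M s).trans ?_
  have h : ∑ i, ‖unifChar M (∑ j, A i j • s j)‖ ≤ ∑ i, (1 - if i ∈ B then (2 / 3 : ℝ) else 0) := by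
    refine Finset.sum_le_sum fun i _ => ?_
    split_ifs with hi
    · linarith [norm_unifChar_le_third M _ (hB i hi)]
    · linarith [norm_unifChar_le_one M (∑ j, A i j • s j)]
  simp only [Finset.sum_sub_distrib, Finset.sum_const, Finset.card_univ, nsmul_eq_mul, mul_one,
    Finset.sum_ite_mem, Finset.univ_inter] at h
  rw [inv_mul_le_iff₀ hcard]
  refine h.trans (le_of_eq ?_)
  field_simp

lemma exists_torsion_near {ν : ℕ} (hν : 0 < ν) {θ : UnitAddCircle} {r : ℝ}
    (h : ‖ν • θ‖ ≤ ν * r) :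
    ∃ m : Fin ν, ‖θ - (((m : ℕ) / ν : ℝ) : UnitAddCircle)‖ ≤ r := by
  have hν' : (0 : ℝ) < ν := by exact_mod_cast hν
  obtain ⟨y, hy, hyn, -⟩ := exists_real_rep (ν • θ)
  have h0 : ν • (θ - ((y / ν : ℝ) : UnitAddCircle)) = 0 := by
    rw [smul_sub, ← hy, ← AddCircle.coe_nsmul, nsmul_eq_mul, mul_div_cancel₀ _ hν'.ne', sub_self]
  obtain ⟨m, hm, hmu⟩ := (AddCircle.nsmul_eq_zero_iff hν).mp h0
  refine ⟨⟨m, hm⟩, ?_⟩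
  rw [mul_one] at hmu
  simp only [hmu, sub_sub_cancel]
  calc ‖((y / ν : ℝ) : UnitAddCircle)‖ ≤ ‖y / ν‖ := QuotientAddGroup.norm_mk_le_norm
    _ = |y| / ν := by rw [Real.norm_eq_abs, abs_div, abs_of_pos hν']
    _ ≤ r := by rw [div_le_iff₀ hν', hyn, mul_comm]; exact h

lemma sum_balanceStep_succ_zsmul {d : ℕ} (s : Fin d → UnitAddCircle) (i : Fin d) :
    ∑ j, balanceStep d i.succ j • s j = s i := by
  simp [balanceStep_succ, ite_smul]

lemma sum_sum_balanceStep_zsmul {d : ℕ} (s : Fin d → UnitAddCircle) :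
    ∑ i, ∑ j, balanceStep d i j • s j = 0 := by
  rw [Finset.sum_comm]
  simp [← Finset.sum_smul, sum_balanceStep]

lemma sum_pairStep_zsmul {I J : Type*} [Fintype J] (A : I → J → ℤ) (p : I × I)
    (s : J ⊕ J → UnitAddCircle) :
    ∑ j, pairStep A p j • s j =
      ∑ j, A p.1 j • s (Sum.inl j) + ∑ j, A p.2 j • s (Sum.inr j) := by
  simp [pairStep]

lemma norm_stepChar_balanceStep_le {d : ℕ} {M : ℕ} (hM : 1 ≤ M) {s : Fin d → UnitAddCircle}
    {C : ℝ} (hC : 3 / 2 ≤ C) (hs : s ∉ torusBox (Fin d) (C / M)) :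
    ‖stepChar (balanceStep d) M s‖ ≤ 1 - 2 / 3 / (d + 1) := by
  have hM' : (0 : ℝ) < M := by exact_mod_cast hM
  simp only [torusBox, Set.mem_ofPred_eq, not_forall, not_le] at hs
  obtain ⟨j, hj⟩ := hs
  rw [div_lt_iff₀' hM'] at hj
  have h := norm_stepChar_le_one_sub (balanceStep d) M s {j.succ} (by
    intro i hi
    rw [Finset.mem_singleton.mp hi, sum_balanceStep_succ_zsmul]
    linarith)
  simpa using h

lemma isProbabilityMeasure_torus (J : Type*) [Fintype J] :
    IsProbabilityMeasure (volume : Measure (J → UnitAddCircle)) := by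
  have : IsProbabilityMeasure (volume : Measure UnitAddCircle) := ⟨UnitAddCircle.measure_univ⟩
  rw [volume_pi]
  infer_instance

/-- The translation of the two tori that moves a secondary peak of the characteristic function
of the pair walk to the origin. -/
noncomputable def peakShift (d : ℕ) (m : Fin (d + 1)) : Fin d ⊕ Fin d → UnitAddCircle :=
  Sum.elim (fun _ => (((m : ℕ) / (d + 1 : ℕ) : ℝ) : UnitAddCircle))
    (fun _ => -(((m : ℕ) / (d + 1 : ℕ) : ℝ) : UnitAddCircle))

lemma sum_balanceStep_zsmul_const {d : ℕ} {a : UnitAddCircle} (ha : (d + 1) • a = 0)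
    (i : Fin (d + 1)) : ∑ j, balanceStep d i j • a = a := by
  refine Fin.cases ?_ (fun i => sum_balanceStep_succ_zsmul (fun _ => a) i) i
  simp only [balanceStep_zero, neg_smul, one_smul, Finset.sum_const, Finset.card_univ,
    Fintype.card_fin]
  rw [succ_nsmul, add_eq_zero_iff_neg_eq] at ha
  rw [smul_neg, ha]

lemma succ_nsmul_coe_div (d m : ℕ) :
    (d + 1) • (((m : ℕ) / (d + 1 : ℕ) : ℝ) : UnitAddCircle) = 0 := by
  rw [← AddCircle.coe_nsmul, nsmul_eq_mul, mul_div_cancel₀ _ (by positivity),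
    AddCircle.coe_eq_zero_iff]
  exact ⟨m, by simp⟩

lemma stepChar_add_peakShift (d : ℕ) (m : Fin (d + 1)) (M : ℕ)
    (s : Fin d ⊕ Fin d → UnitAddCircle) :
    stepChar (pairStep (balanceStep d)) M (s + peakShift d m) =
      stepChar (pairStep (balanceStep d)) M s := by
  have ha := succ_nsmul_coe_div d m
  simp only [stepChar]
  congr 1
  refine Finset.sum_congr rfl fun p _ => ?_
  congr 1
  rw [sum_pairStep_zsmul, sum_pairStep_zsmul]
  simp only [Pi.add_apply, peakShift, Sum.elim_inl, Sum.elim_inr, smul_add, smul_neg,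
    Finset.sum_add_distrib, Finset.sum_neg_distrib, sum_balanceStep_zsmul_const ha]
  abel

lemma exists_forall_notMem_of_card_le_two {d : ℕ} (hd : 2 ≤ d) {B : Finset (Fin (d + 1))}
    (hB : B.card ≤ 2) : ∃ k, k ∉ B := by
  by_contra! h
  have : B = Finset.univ := Finset.eq_univ_iff_forall.mpr h
  rw [this, Finset.card_univ, Fintype.card_fin] at hB
  omega

lemma norm_stepChar_pairStep_le_or_mem {d : ℕ} (hd : 2 ≤ d) {M : ℕ} (hM : 1 ≤ M)
    (s : Fin d ⊕ Fin d → UnitAddCircle) :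
    ‖stepChar (pairStep (balanceStep d)) M s‖ ≤ 1 - 2 / (d + 1 : ℝ) ^ 2 ∨
      ∃ m, s + peakShift d m ∈ torusBox (Fin d ⊕ Fin d) (9 / 2 / M) := by
  classical
  have hM' : (0 : ℝ) < M := by exact_mod_cast hM
  set S : Fin (d + 1) → UnitAddCircle := fun i => ∑ j, balanceStep d i j • s (Sum.inl j) with hS
  set T : Fin (d + 1) → UnitAddCircle := fun i => ∑ j, balanceStep d i j • s (Sum.inr j) with hT
  have hS0 : ∑ i, S i = 0 := sum_sum_balanceStep_zsmul _
  have hrow : ∀ p : Fin (d + 1) × Fin (d + 1),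
      ∑ j, pairStep (balanceStep d) p j • s j = S p.1 + T p.2 := fun p => sum_pairStep_zsmul _ p s
  set B : Finset (Fin (d + 1) × Fin (d + 1)) :=
    Finset.univ.filter fun p => 3 / 2 ≤ M * ‖S p.1 + T p.2‖ with hB
  rcases le_or_gt 3 B.card with hcard | hcard
  · left
    refine (norm_stepChar_le_one_sub (pairStep (balanceStep d)) M s B fun p hp => ?_).trans ?_
    · rw [hrow]
      exact (Finset.mem_filter.mp hp).2
    · have h3 : (3 : ℝ) ≤ B.card := by exact_mod_cast hcard
      rw [Fintype.card_prod, Fintype.card_fin]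
      push_cast
      rw [← sq]
      gcongr
      linarith
  · right
    set r : ℝ := 3 / 2 / M with hr
    have hgood : ∀ p, p ∉ B → ‖S p.1 + T p.2‖ ≤ r := by
      intro p hp
      have : ¬ 3 / 2 ≤ M * ‖S p.1 + T p.2‖ := by simpa [hB] using hp
      rw [hr, le_div_iff₀ hM', mul_comm]
      exact (not_le.mp this).le
    obtain ⟨k₀, hk₀⟩ := exists_forall_notMem_of_card_le_two hd (B := B.image Prod.snd)
      (Finset.card_image_le.trans (by omega))
    obtain ⟨i₀, hi₀⟩ := exists_forall_notMem_of_card_le_two hd (B := B.image Prod.fst)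
      (Finset.card_image_le.trans (by omega))
    have hk : ∀ i, ‖S i + T k₀‖ ≤ r := fun i => hgood (i, k₀) fun h =>
      hk₀ (Finset.mem_image_of_mem Prod.snd h)
    have hi : ∀ k, ‖S i₀ + T k‖ ≤ r := fun k => hgood (i₀, k) fun h =>
      hi₀ (Finset.mem_image_of_mem Prod.fst h)
    have hT0 : ‖(d + 1) • T k₀‖ ≤ (d + 1 : ℕ) * r := by
      have : ∑ i, (S i + T k₀) = (d + 1) • T k₀ := by
        rw [Finset.sum_add_distrib, hS0]
        simp
      rw [← this]
      refine (norm_sum_le _ _).trans ((Finset.sum_le_sum fun i _ => hk i).trans ?_)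
      simp
    obtain ⟨m, hm⟩ := exists_torsion_near (Nat.succ_pos d) hT0
    set a : UnitAddCircle := (((m : ℕ) / (d + 1 : ℕ) : ℝ) : UnitAddCircle) with ha
    have hSa : ∀ i, ‖S i + a‖ ≤ 2 * r := fun i => by
      have : S i + a = (S i + T k₀) - (T k₀ - a) := by abel
      rw [this]
      linarith [norm_sub_le (S i + T k₀) (T k₀ - a), hk i]
    have hTa : ∀ k, ‖T k - a‖ ≤ 3 * r := fun k => by
      have : T k - a = (S i₀ + T k) - (S i₀ + a) := by abel
      rw [this]
      linarith [norm_sub_le (S i₀ + T k) (S i₀ + a), hi k, hSa i₀]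
    have h3 : 3 * r = 9 / 2 / M := by rw [hr]; ring
    have hr0 : 0 ≤ r := by positivity
    refine ⟨m, fun j => ?_⟩
    rw [← h3]
    rcases j with j | j
    · have h := hSa j.succ
      simp only [hS, sum_balanceStep_succ_zsmul (fun j => s (Sum.inl j))] at h
      simp only [Pi.add_apply, peakShift, Sum.elim_inl]
      exact h.trans (by linarith)
    · have h := hTa j.succ
      simp only [hT, sum_balanceStep_succ_zsmul (fun j => s (Sum.inr j))] at h
      simp only [Pi.add_apply, peakShift, Sum.elim_inr, ← sub_eq_add_neg]
      exact h

lemma integral_norm_stepChar_pairStep_pow_le {d : ℕ} (hd : 2 ≤ d) {M : ℕ} (hM : 1 ≤ M) (n : ℕ) :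
    ∫ s, ‖stepChar (pairStep (balanceStep d)) M s ^ n‖ ≤
      (1 - 2 / (d + 1 : ℝ) ^ 2) ^ n +
        (d + 1) * ∫ s in torusBox (Fin d ⊕ Fin d) (9 / 2 / M),
          ‖stepChar (pairStep (balanceStep d)) M s ^ n‖ := by
  have := isProbabilityMeasure_torus (Fin d ⊕ Fin d)
  set f : (Fin d ⊕ Fin d → UnitAddCircle) → ℝ :=
    fun s => ‖stepChar (pairStep (balanceStep d)) M s ^ n‖ with hf
  set E := torusBox (Fin d ⊕ Fin d) (9 / 2 / M) with hE
  have hfi : Integrable f := (integrable_stepChar_pow _ M n).norm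
  have hEm : MeasurableSet E := (isClosed_torusBox _).measurableSet
  have hgi : Integrable (E.indicator f) := hfi.indicator hEm
  have hgi' : ∀ m, Integrable fun s => E.indicator f (s + peakShift d m) := fun m =>
    hgi.comp_add_right (peakShift d m)
  have hd' : (0 : ℝ) ≤ 1 - 2 / (d + 1 : ℝ) ^ 2 := by
    have : (2 : ℝ) ≤ d := by exact_mod_cast hd
    rw [sub_nonneg, div_le_one (by positivity)]
    nlinarith
  have hpt : ∀ s, f s ≤ (1 - 2 / (d + 1 : ℝ) ^ 2) ^ n +
      ∑ m, E.indicator f (s + peakShift d m) := by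
    intro s
    have h0 : ∀ m, 0 ≤ E.indicator f (s + peakShift d m) := fun m =>
      Set.indicator_nonneg (fun _ _ => norm_nonneg _) _
    rcases norm_stepChar_pairStep_le_or_mem hd hM s with h | ⟨m, hm⟩
    · refine le_add_of_le_of_nonneg ?_ (Finset.sum_nonneg fun m _ => h0 m)
      rw [hf]
      simp only [norm_pow]
      gcongr
    · have h1 : f s = E.indicator f (s + peakShift d m) := by
        rw [Set.indicator_of_mem hm, hf]
        simp only [stepChar_add_peakShift]
      rw [h1]
      exact le_add_of_nonneg_of_le (by positivity)
        (Finset.single_le_sum (fun m _ => h0 m) (Finset.mem_univ m))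
  calc ∫ s, f s ≤ ∫ s, ((1 - 2 / (d + 1 : ℝ) ^ 2) ^ n +
        ∑ m, E.indicator f (s + peakShift d m)) :=
      integral_mono hfi ((integrable_const _).add (integrable_finsetSum _ fun m _ => hgi' m)) hpt
    _ = _ := by
      rw [integral_add (integrable_const _) (integrable_finsetSum _ fun m _ => hgi' m),
        integral_finsetSum _ fun m _ => hgi' m]
      simp only [integral_add_right_eq_self (E.indicator f), integral_indicator hEm]
      simp

lemma abs_integral_re_stepChar_balanceStep_sub_le {d : ℕ} {M : ℕ} (hM : 1 ≤ M) (n : ℕ)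
    {C : ℝ} (hC : 3 / 2 ≤ C) :
    |(∫ s, (stepChar (balanceStep d) M s ^ n).re) -
      ∫ s in torusBox (Fin d) (C / M), (stepChar (balanceStep d) M s ^ n).re| ≤
      (1 - 2 / 3 / (d + 1 : ℝ)) ^ n := by
  have := isProbabilityMeasure_torus (Fin d)
  have hEm : MeasurableSet (torusBox (Fin d) (C / M)) := (isClosed_torusBox _).measurableSet
  have hfi : Integrable fun s => (stepChar (balanceStep d) M s ^ n).re :=
    (integrable_stepChar_pow _ M n).re
  rw [← integral_add_compl hEm hfi, add_sub_cancel_left, ← Real.norm_eq_abs]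
  have hd' : (0 : ℝ) ≤ 1 - 2 / 3 / (d + 1 : ℝ) := by
    rw [sub_nonneg, div_le_one (by positivity)]
    have : (0 : ℝ) ≤ d := by positivity
    linarith
  refine (norm_setIntegral_le_of_norm_le_const (measure_lt_top _ _)
    (C := (1 - 2 / 3 / (d + 1 : ℝ)) ^ n) fun s hs => ?_).trans ?_
  · refine (Complex.abs_re_le_norm _).trans ?_
    rw [norm_pow]
    gcongr
    exact norm_stepChar_balanceStep_le hM hC hs
  · exact mul_le_of_le_one_right (by positivity) measureReal_le_one

end FarRegion

section MomentAsymptotics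

lemma tendsto_scale_pow_mul_pow_zero {M : ℕ → ℕ} (hM1 : ∀ n, 1 ≤ M n) {κ r : ℝ} (d : ℕ)
    (hκ : Tendsto (fun n : ℕ => (n : ℝ) / Real.log (M n)) atTop (𝓝 κ)) (hr : 0 < r) (hr1 : r < 1)
    (hκgt : 2 * d / Real.log r⁻¹ < κ) :
    Tendsto (fun n : ℕ => (M n * √n) ^ (d + d) * r ^ n) atTop (𝓝 0) := by
  have hlog : 0 < Real.log r⁻¹ := Real.log_pos ((one_lt_inv₀ hr).mpr hr1)
  obtain ⟨κ', hκ'1, hκ'2⟩ := exists_between hκgt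
  have hκ'0 : 0 < κ' := lt_of_le_of_lt (by positivity) hκ'1
  set q : ℝ := Real.exp (2 * d / κ') * r with hq
  have hq0 : 0 < q := by positivity
  have hq1 : q < 1 := by
    have h : 2 * d / κ' < Real.log r⁻¹ := by
      rw [div_lt_iff₀ hlog] at hκ'1
      rw [div_lt_iff₀ hκ'0]
      linarith
    have h2 : Real.exp (2 * d / κ') < r⁻¹ := by
      rw [← Real.exp_log (inv_pos.mpr hr)]
      exact Real.exp_lt_exp.mpr h
    calc q < r⁻¹ * r := by rw [hq]; gcongr
      _ = 1 := inv_mul_cancel₀ hr.ne'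
  refine squeeze_zero' (Eventually.of_forall fun n => by positivity) ?_
    (tendsto_pow_const_mul_const_pow_of_abs_lt_one d (by rwa [abs_of_pos hq0]))
  filter_upwards [hκ.eventually (lt_mem_nhds hκ'2)] with n hn
  have hM0 : (1 : ℝ) ≤ M n := by exact_mod_cast hM1 n
  have hlogM : 0 < Real.log (M n) := by
    refine lt_of_le_of_ne (Real.log_nonneg hM0) fun h => ?_
    rw [← h, div_zero] at hn
    linarith
  rw [lt_div_iff₀ hlogM] at hn
  have h1 : (M n : ℝ) ^ (d + d) ≤ Real.exp (2 * d / κ') ^ n := by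
    rw [← Real.exp_log (lt_of_lt_of_le one_pos hM0), ← Real.exp_nat_mul, ← Real.exp_nat_mul,
      Real.exp_le_exp, ← mul_div_assoc,
      le_div_iff₀ hκ'0]
    push_cast
    have hd : (0 : ℝ) ≤ d := by positivity
    nlinarith
  have h2 : (√n) ^ (d + d) = (n : ℝ) ^ d := by
    rw [← two_mul, pow_mul, Real.sq_sqrt (Nat.cast_nonneg n)]
  calc (M n * √n) ^ (d + d) * r ^ n = (M n : ℝ) ^ (d + d) * (n ^ d * r ^ n) := by
        rw [mul_pow, h2, mul_assoc]
    _ ≤ Real.exp (2 * d / κ') ^ n * (n ^ d * r ^ n) := by gcongr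
    _ = n ^ d * q ^ n := by rw [hq, mul_pow]; ring

lemma tendsto_scale_pow_mul_pow_zero_of_sq_le {N : ℕ → ℝ} (hN : ∀ n, 0 ≤ N n) {d : ℕ} {r r' : ℝ}
    (hr' : 0 ≤ r') (hrr : r' ^ 2 ≤ r)
    (h : Tendsto (fun n => N n ^ (d + d) * r ^ n) atTop (𝓝 0)) :
    Tendsto (fun n => N n ^ d * r' ^ n) atTop (𝓝 0) := by
  have h2 : Tendsto (fun n => √(N n ^ (d + d) * r ^ n)) atTop (𝓝 0) := by
    simpa using h.sqrt
  refine squeeze_zero (fun n => mul_nonneg (pow_nonneg (hN n) _) (pow_nonneg hr' _))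
    (fun n => Real.le_sqrt_of_sq_le ?_) h2
  have hN' : 0 ≤ N n ^ (d + d) := pow_nonneg (hN n) _
  calc (N n ^ d * r' ^ n) ^ 2 = N n ^ (d + d) * (r' ^ 2) ^ n := by ring
    _ ≤ N n ^ (d + d) * r ^ n := by gcongr

lemma tendsto_integral_re_stepChar_balanceStep {d : ℕ} {M : ℕ → ℕ} (hM1 : ∀ n, 1 ≤ M n)
    (hMtop : Tendsto M atTop atTop)
    (h0 : Tendsto (fun n : ℕ => (M n * √n) ^ d * (1 - 2 / 3 / (d + 1 : ℝ)) ^ n) atTop (𝓝 0)) :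
    Tendsto (fun n : ℕ => (M n * √n) ^ d * ∫ s, (stepChar (balanceStep d) (M n) s ^ n).re) atTop
      (𝓝 (∫ w : Fin d → ℝ, Real.exp (-stepForm (balanceStep d) w))) := by
  have h1 := tendsto_setIntegral_stepChar_pow hMtop (sum_balanceStep d) (le_sum_sq_balanceStep d)
    (C := 9 / 2) (by norm_num) Complex.continuous_re Complex.abs_re_le_norm
    (fun x _ => Complex.ofReal_re x)
  rw [Fintype.card_fin] at h1
  have h2 : Tendsto (fun n : ℕ => (M n * √n) ^ d *
      ((∫ s, (stepChar (balanceStep d) (M n) s ^ n).re) -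
        ∫ s in torusBox (Fin d) (9 / 2 / M n), (stepChar (balanceStep d) (M n) s ^ n).re))
      atTop (𝓝 0) := by
    refine squeeze_zero_norm (fun n => ?_) h0
    rw [norm_mul, Real.norm_eq_abs, Real.norm_eq_abs, abs_of_nonneg (by positivity)]
    gcongr
    exact abs_integral_re_stepChar_balanceStep_sub_le (hM1 n) n (by norm_num)
  simpa [← mul_add] using h2.add h1

lemma eventually_integral_re_pairStep_le {d : ℕ} (hd : 2 ≤ d) {M : ℕ → ℕ} (hM1 : ∀ n, 1 ≤ M n)
    (hMtop : Tendsto M atTop atTop) {κ : ℝ}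
    (hκ : Tendsto (fun n : ℕ => (n : ℝ) / Real.log (M n)) atTop (𝓝 κ))
    (hκgt : 2 * d / Real.log (1 - 2 / (d + 1 : ℝ) ^ 2)⁻¹ < κ) {c : ℝ} (hc : (d : ℝ) + 1 < c) :
    ∀ᶠ n : ℕ in atTop, 0 < ∫ s, (stepChar (balanceStep d) (M n) s ^ n).re ∧
      ∫ s, (stepChar (pairStep (balanceStep d)) (M n) s ^ n).re ≤
        c * (∫ s, (stepChar (balanceStep d) (M n) s ^ n).re) ^ 2 := by
  have hd' : (2 : ℝ) ≤ d := by exact_mod_cast hd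
  have hr0 : 0 < 1 - 2 / (d + 1 : ℝ) ^ 2 := by
    rw [sub_pos, div_lt_one (by positivity)]
    nlinarith
  have hr1 : 1 - 2 / (d + 1 : ℝ) ^ 2 < 1 := sub_lt_self _ (by positivity)
  have hrr : (1 - 2 / 3 / (d + 1 : ℝ)) ^ 2 ≤ 1 - 2 / (d + 1 : ℝ) ^ 2 := by
    have : 1 - 2 / (d + 1 : ℝ) ^ 2 - (1 - 2 / 3 / (d + 1 : ℝ)) ^ 2 =
        (12 * (d + 1) - 22) / (9 * (d + 1 : ℝ) ^ 2) := by
      field_simp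
      ring
    have h2 : 0 ≤ (12 * (d + 1) - 22) / (9 * (d + 1 : ℝ) ^ 2) :=
      div_nonneg (by linarith) (by positivity)
    linarith
  have hr'0 : 0 ≤ 1 - 2 / 3 / (d + 1 : ℝ) := by
    rw [sub_nonneg, div_le_one (by positivity)]
    linarith
  set G := ∫ w : Fin d → ℝ, Real.exp (-stepForm (balanceStep d) w) with hG
  have hGpos : 0 < G := integral_exp_neg_stepForm_pos (le_sum_sq_balanceStep d)
  have hfar := tendsto_scale_pow_mul_pow_zero hM1 d hκ hr0 hr1 hκgt
  have hfirst := tendsto_integral_re_stepChar_balanceStep hM1 hMtop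
    (tendsto_scale_pow_mul_pow_zero_of_sq_le (fun n => by positivity) hr'0 hrr hfar)
  have hnear := tendsto_setIntegral_stepChar_pow hMtop (sum_pairStep (sum_balanceStep d))
    (le_sum_sq_pairStep (sum_balanceStep d) (le_sum_sq_balanceStep d))
    (C := 9 / 2) (by norm_num) continuous_norm (fun z => (abs_norm z).le)
    (fun x hx => by rw [Complex.norm_real, Real.norm_eq_abs, abs_of_nonneg hx])
  rw [integral_exp_neg_stepForm_pairStep (sum_balanceStep d), Fintype.card_sum,
    Fintype.card_fin] at hnear
  have hupper := hfar.add (hnear.const_mul ((d : ℝ) + 1))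
  rw [zero_add] at hupper
  have hsquare := (hfirst.pow 2).const_mul c
  have hlt : ((d : ℝ) + 1) * G ^ 2 < c * G ^ 2 := by gcongr
  filter_upwards [hfirst.eventually (lt_mem_nhds hGpos), hupper.eventually_lt hsquare hlt,
    eventually_ge_atTop 1] with n hpos hle hn
  have hN : (0 : ℝ) < M n * √n := by
    have : (0 : ℝ) < M n := by exact_mod_cast hM1 n
    have : (0 : ℝ) < n := by exact_mod_cast hn
    positivity
  refine ⟨pos_of_mul_pos_right hpos (by positivity), ?_⟩
  have hint := integrable_stepChar_pow (pairStep (balanceStep d)) (M n) n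
  have h1 : ∫ s, (stepChar (pairStep (balanceStep d)) (M n) s ^ n).re ≤
      ∫ s, ‖stepChar (pairStep (balanceStep d)) (M n) s ^ n‖ :=
    integral_mono hint.re hint.norm fun s => Complex.re_le_norm _
  have h2 := h1.trans (integral_norm_stepChar_pairStep_pow_le hd (hM1 n) n)
  refine le_of_mul_le_mul_left ?_ (pow_pos hN (d + d))
  refine (mul_le_mul_of_nonneg_left h2 (by positivity)).trans (le_trans (le_of_eq ?_)
    (hle.le.trans (le_of_eq ?_)))
  · ring
  · ring

end MomentAsymptotics

section Cantelli

/-- The one-sided Chebyshev inequality for a variable with the given bound on its second moment. -/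
lemma le_ncard_div_of_sum_sq_le {Ω : Type*} [Fintype Ω] [Nonempty Ω] {Z : Ω → ℝ} {e v δ : ℝ}
    (hsum : ∑ ω, Z ω = Fintype.card Ω * e) (he : 0 < e)
    (hsq : ∑ ω, Z ω ^ 2 ≤ Fintype.card Ω * ((1 + v) * e ^ 2)) (hv : 0 < v) (hδ : δ < 1) :
    (1 - δ) ^ 2 / ((1 - δ) ^ 2 + v) ≤ (Set.ncard {ω | δ * e ≤ Z ω} : ℝ) / Fintype.card Ω := by
  classical
  have hcard : (0 : ℝ) < Fintype.card Ω := by exact_mod_cast Fintype.card_pos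
  obtain ⟨t, ht⟩ : ∃ t, t = 1 - δ := ⟨_, rfl⟩
  have ht0 : 0 < t := by linarith
  rw [← ht]
  have hpt : ∀ ω, ((t ^ 2 + v) * e) ^ 2 * (1 - if δ * e ≤ Z ω then 1 else 0) ≤
      ((t + v) * e - t * Z ω) ^ 2 := by
    intro ω
    split_ifs with h
    · simpa using sq_nonneg _
    · rw [sub_zero, mul_one]
      have : t * Z ω ≤ t * (δ * e) := by gcongr; exact (not_le.mp h).le
      have hδ' : δ = 1 - t := by linarith
      rw [hδ'] at this
      refine pow_le_pow_left₀ (by positivity) ?_ 2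
      nlinarith
  have hsumle := Finset.sum_le_sum fun ω (_ : ω ∈ Finset.univ) => hpt ω
  have hcount : ∑ ω, (if δ * e ≤ Z ω then (1 : ℝ) else 0) = Set.ncard {ω | δ * e ≤ Z ω} := by
    rw [Finset.sum_boole, Set.ncard_eq_toFinset_card']
    simp
  have hexp : ∑ ω, ((t + v) * e - t * Z ω) ^ 2 =
      Fintype.card Ω * ((t + v) * e) ^ 2 - 2 * ((t + v) * e) * t * ∑ ω, Z ω +
        t ^ 2 * ∑ ω, Z ω ^ 2 := by
    simp only [sub_sq, mul_pow, Finset.sum_add_distrib, Finset.sum_sub_distrib, Finset.sum_const,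
      Finset.card_univ, nsmul_eq_mul, Finset.mul_sum]
    congr 2
    exact Finset.sum_congr rfl fun ω _ => by ring
  rw [← Finset.mul_sum, Finset.sum_sub_distrib, hcount, hexp, hsum] at hsumle
  simp only [Finset.sum_const, Finset.card_univ, nsmul_eq_mul, mul_one] at hsumle
  set c : ℝ := ((Set.ncard {ω | δ * e ≤ Z ω} : ℕ) : ℝ)
  set K : ℝ := (Fintype.card Ω : ℝ)
  have h2 := mul_le_mul_of_nonneg_left hsq (sq_nonneg t)
  have h3 : ((t ^ 2 + v) * e) ^ 2 * (K - c) ≤ K * e ^ 2 * (v * (t ^ 2 + v)) := by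
    refine hsumle.trans ((add_le_add_right h2 _).trans (le_of_eq ?_))
    ring
  have h4 : ((t ^ 2 + v) * e ^ 2) * ((t ^ 2 + v) * (K - c)) ≤
      ((t ^ 2 + v) * e ^ 2) * (K * v) := by
    refine le_trans (le_of_eq ?_) (h3.trans (le_of_eq ?_)) <;> ring
  have h5 := le_of_mul_le_mul_left h4 (by positivity)
  rw [div_le_div_iff₀ (by positivity) hcard]
  linarith

end Cantelli

section Moments

variable {d n M : ℕ}

lemma sum_perfectCount_pow_eq (hn : 1 ≤ n) (k : ℕ) :
    ∑ X : Fin n → Fin M, ((perfectCount (d + 1) n fun j => (X j : ℕ) + 1) : ℝ) ^ k =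
      ∑ X : Fin n → Fin M, (zeroSumCount (balanceStep d) n fun j => (X j : ℕ) + 1 : ℝ) ^ k := by
  refine Finset.sum_congr rfl fun X _ => ?_
  rw [perfectCount_eq_zeroSumCount hn _ fun m => Nat.succ_pos _]

lemma EZ_eq (hn : 1 ≤ n) :
    EZ (d + 1) n M = (d + 1 : ℝ) ^ n * ∫ s, (stepChar (balanceStep d) M s ^ n).re := by
  have h := sum_perfectCount_pow_eq (d := d) (M := M) hn 1
  simp only [pow_one] at h
  rw [EZ, h, integral_re_stepChar_pow, Fintype.card_fin]
  push_cast
  field_simp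

lemma sum_sq_perfectCount (hn : 1 ≤ n) (hM : 1 ≤ M) :
    ∑ X : Fin n → Fin M, ((perfectCount (d + 1) n fun j => (X j : ℕ) + 1) : ℝ) ^ 2 =
      (M : ℝ) ^ n * (((d + 1 : ℝ) ^ n) ^ 2 *
        ∫ s, (stepChar (pairStep (balanceStep d)) M s ^ n).re) := by
  have hM' : (0 : ℝ) < M := by exact_mod_cast hM
  rw [sum_perfectCount_pow_eq hn, integral_re_stepChar_pow, Fintype.card_prod, Fintype.card_fin]
  simp only [zeroSumCount_pairStep]
  push_cast
  field_simp
  rw [← pow_mul, ← pow_mul, mul_comm 2 n]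

end Moments

theorem number_of_perfect_partitions_large_with_positive_probability
    (ν : ℕ) (hν : 3 ≤ ν) (M : ℕ → ℕ) (hM1 : ∀ n, 1 ≤ M n)
    (hMtop : Tendsto M atTop atTop)
    (hMO : ∃ C : ℝ, ∀ n : ℕ, Real.log (M n) ≤ C * n)
    (κ : ℝ)
    (hκ : Tendsto (fun n : ℕ => (n : ℝ) / Real.log (M n)) atTop (nhds κ))
    (hκgt : 2 * ((ν : ℝ) - 1) / Real.log ((1 - 2 / (ν : ℝ) ^ 2)⁻¹) < κ) :
    ∀ δ : ℝ, δ ∈ Set.Ioo (0 : ℝ) 1 →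
      (1 - δ) ^ 2 / ((1 - δ) ^ 2 + (ν : ℝ) ^ 2) ≤
        Filter.liminf (fun n => prGE ν n (M n) (δ * EZ ν n (M n))) atTop := by
  rintro δ ⟨-, hδ⟩
  obtain ⟨d, rfl⟩ : ∃ d, ν = d + 1 := ⟨ν - 1, by omega⟩
  have hd : 2 ≤ d := by omega
  push_cast at hκgt ⊢
  rw [add_sub_cancel_right] at hκgt
  have hev := eventually_integral_re_pairStep_le hd hM1 hMtop hκ hκgt
    (c := 1 + (d + 1 : ℝ) ^ 2) (by nlinarith)
  have hcob : IsCoboundedUnder (· ≥ ·) atTop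
      fun n => prGE (d + 1) n (M n) (δ * EZ (d + 1) n (M n)) := by
    refine (isBoundedUnder_of ⟨1, fun n => ?_⟩).isCoboundedUnder_ge
    refine div_le_one_of_le₀ ?_ (by positivity)
    exact_mod_cast (Set.ncard_le_card _).trans_eq (by simp)
  refine le_liminf_of_le hcob ?_
  filter_upwards [hev, eventually_ge_atTop 1] with n hn hn1
  obtain ⟨hpos, hle⟩ := hn
  have hM0 : (0 : ℝ) < M n := by exact_mod_cast hM1 n
  have : Nonempty (Fin (M n)) := ⟨⟨0, hM1 n⟩⟩
  have hcard : (Fintype.card (Fin n → Fin (M n)) : ℝ) = (M n : ℝ) ^ n := by simp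
  have hE := EZ_eq (d := d) (M := M n) hn1
  have key := le_ncard_div_of_sum_sq_le (v := (d + 1 : ℝ) ^ 2) (e := EZ (d + 1) n (M n)) (δ := δ)
    (Z := fun X : Fin n → Fin (M n) => ((perfectCount (d + 1) n fun j => (X j : ℕ) + 1) : ℝ))
    (by rw [hcard, EZ, mul_div_cancel₀ _ (by positivity)])
    (by rw [hE]; positivity)
    (by
      rw [sum_sq_perfectCount hn1 (hM1 n), hcard, hE, mul_pow, mul_left_comm (1 + _)]
      gcongr)
    (by positivity) hδ
  rwa [hcard] at key
end

section
/- Fix an integer ν ≥ 3 and positive integers n, X_1,…,X_n. Let Z_n be the number of ordered partitions (S_1,…,S_ν) of {1,…,n} into ν nonempty pairwise disjoint subsets such that the ν sums Σ_{j∈S_α} X_j are all equal. Then Z_n = (2π)^{−ν} ∫_{[−π,π]^ν} Π_{j=1}^n f(x, X_j) dx, where for x = (x_1,…,x_ν) ∈ ℝ^ν one sets y_α(x) := ν·x_α − Σ_{β=1}^ν x_β and f(x, η) := Σ_{α=1}^ν exp(i·y_α(x)·η). -/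
open MeasureTheory

/-- Orthogonality of the characters `x ↦ exp (i m x)` on `[-π, π]`. -/
theorem integral_Icc_exp_int_mul_I (m : ℤ) :
    ∫ x : ℝ in Set.Icc (-Real.pi) Real.pi, Complex.exp (Complex.I * m * x) =
      if m = 0 then ((2 * Real.pi : ℝ) : ℂ) else 0 := by
  have hπ : -Real.pi ≤ Real.pi := by linarith [Real.pi_pos]
  rw [integral_Icc_eq_integral_Ioc, ← intervalIntegral.integral_of_le hπ]
  split_ifs with hm
  · subst hm
    simp
    ring
  · have hc : Complex.I * (m : ℂ) ≠ 0 :=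
      mul_ne_zero Complex.I_ne_zero (Int.cast_ne_zero.mpr hm)
    rw [integral_exp_mul_complex hc, div_eq_zero_iff, sub_eq_zero]
    refine Or.inl (Complex.exp_eq_exp_iff_exists_int.mpr ⟨m, ?_⟩)
    push_cast
    ring

/-- Orthogonality of the characters `x ↦ ∏ β, exp (i m_β x_β)` on the cube `[-π, π]^ι`. -/
theorem integral_cube_prod_exp_int_mul_I {ι : Type*} [Fintype ι] (m : ι → ℤ) :
    ∫ x : ι → ℝ in Set.univ.pi fun _ : ι => Set.Icc (-Real.pi) Real.pi,
        ∏ β, Complex.exp (Complex.I * m β * x β) =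
      if ∀ β, m β = 0 then (((2 * Real.pi) ^ Fintype.card ι : ℝ) : ℂ) else 0 := by
  rw [volume_pi, Measure.restrict_pi_pi,
    integral_fintype_prod_eq_prod (fun β (t : ℝ) => Complex.exp (Complex.I * m β * t))]
  simp_rw [integral_Icc_exp_int_mul_I, Finset.prod_ite_zero]
  simp

/-- The sum of the weights in block `α` of the assignment `σ`. -/
def blockSum {ι κ : Type*} [Fintype ι] [DecidableEq κ] (X : ι → ℕ) (σ : ι → κ) (α : κ) : ℕ :=
  ∑ j with σ j = α, X j

theorem sum_blockSum {ι κ : Type*} [Fintype ι] [Fintype κ] [DecidableEq κ]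
    (X : ι → ℕ) (σ : ι → κ) : ∑ α, blockSum X σ α = ∑ j, X j :=
  Finset.sum_fiberwise _ _ _

theorem sum_comp_mul_eq_sum_blockSum {ι κ : Type*} [Fintype ι] [Fintype κ] [DecidableEq κ]
    (X : ι → ℕ) (σ : ι → κ) (z : κ → ℂ) :
    ∑ j, z (σ j) * X j = ∑ α, z α * blockSum X σ α := by
  rw [← Finset.sum_fiberwise Finset.univ σ]
  refine Finset.sum_congr rfl fun α _ => ?_
  rw [blockSum, Nat.cast_sum, Finset.mul_sum]
  refine Finset.sum_congr rfl fun j hj => ?_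
  rw [(Finset.mem_filter.mp hj).2]

/-- The contribution of an assignment `σ` to the expanded product is a character of the torus. -/
theorem prod_exp_assignment {ι κ : Type*} [Fintype ι] [Fintype κ] [DecidableEq κ]
    (X : ι → ℕ) (σ : ι → κ) (c : ℕ) (x : κ → ℝ) :
    ∏ j, Complex.exp (Complex.I * (((c : ℝ) * x (σ j) - ∑ β, x β : ℝ) : ℂ) * (X j : ℂ)) =
      ∏ β, Complex.exp (Complex.I * ((c * blockSum X σ β - ∑ j, X j : ℤ) : ℂ) * x β) := by
  rw [← Complex.exp_sum, ← Complex.exp_sum]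
  congr 1
  have h := sum_comp_mul_eq_sum_blockSum X σ (fun α => (x α : ℂ))
  have hl : ∑ j, Complex.I * (((c : ℝ) * x (σ j) - ∑ β, x β : ℝ) : ℂ) * (X j : ℂ) =
      Complex.I * (c * ∑ j, (x (σ j) : ℂ) * X j - (∑ β, (x β : ℂ)) * ∑ j, (X j : ℂ)) := by
    rw [Finset.mul_sum, Finset.mul_sum, ← Finset.sum_sub_distrib, Finset.mul_sum]
    refine Finset.sum_congr rfl fun j _ => ?_
    push_cast
    ring
  rw [hl, h, Finset.mul_sum, Finset.sum_mul, ← Finset.sum_sub_distrib, Finset.mul_sum]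
  refine Finset.sum_congr rfl fun β _ => ?_
  push_cast
  ring

/-- All frequencies vanish exactly for the perfect partitions; positivity of the weights
makes every block of such a partition nonempty. -/
theorem frequencies_eq_zero_iff {ι κ : Type*} [Fintype ι] [Fintype κ] [DecidableEq κ]
    [Nonempty ι] [Nonempty κ] (X : ι → ℕ) (hX : ∀ j, 1 ≤ X j) (σ : ι → κ) :
    (∀ β, (Fintype.card κ * blockSum X σ β - ∑ j, X j : ℤ) = 0) ↔
      Function.Surjective σ ∧ ∀ α β, blockSum X σ α = blockSum X σ β := by
  have hκ : 0 < Fintype.card κ := Fintype.card_pos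
  constructor
  · intro h
    have h' : ∀ β, Fintype.card κ * blockSum X σ β = ∑ j, X j := fun β => by
      exact_mod_cast sub_eq_zero.mp (h β)
    refine ⟨fun β => ?_, fun α β => Nat.eq_of_mul_eq_mul_left hκ ((h' α).trans (h' β).symm)⟩
    by_contra! hβ
    have hzero : blockSum X σ β = 0 :=
      Finset.sum_eq_zero fun j hj => absurd (Finset.mem_filter.mp hj).2 (hβ j)
    have hpos : 0 < ∑ j, X j := Finset.sum_pos (fun j _ => hX j) Finset.univ_nonempty
    have := h' β
    rw [hzero] at this
    omega
  · rintro ⟨-, h⟩ β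
    have hsum : ∑ j, X j = Fintype.card κ * blockSum X σ β := by
      rw [← sum_blockSum X σ, Finset.sum_congr rfl fun α _ => h α β]
      simp
    rw [sub_eq_zero]
    exact_mod_cast hsum.symm

theorem integral_formula_for_Zn
    (ν : ℕ) (hν : 3 ≤ ν) (n : ℕ) (hn : 1 ≤ n) (X : Fin n → ℕ) (hX : ∀ j, 1 ≤ X j) :
    ((perfectCount ν n X : ℝ) : ℂ) =
      (((1 : ℝ) / (2 * Real.pi) ^ ν : ℝ) : ℂ) *
        ∫ x : Fin ν → ℝ in Set.univ.pi fun _ : Fin ν => Set.Icc (-Real.pi) Real.pi,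
          ∏ j : Fin n, ∑ α : Fin ν,
            Complex.exp (Complex.I *
              (((ν : ℝ) * x α - ∑ β : Fin ν, x β : ℝ) : ℂ) * ((X j : ℕ) : ℂ)) := by
  have : Nonempty (Fin n) := ⟨⟨0, hn⟩⟩
  have : Nonempty (Fin ν) := ⟨⟨0, by omega⟩⟩
  have hπ : (((2 * Real.pi) ^ ν : ℝ) : ℂ) ≠ 0 :=
    Complex.ofReal_ne_zero.mpr (pow_ne_zero _ Real.two_pi_pos.ne')
  simp_rw [Fintype.prod_sum, prod_exp_assignment X]
  rw [integral_finsetSum]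
  · have hfreq := frequencies_eq_zero_iff (κ := Fin ν) X hX
    rw [Fintype.card_fin] at hfreq
    have hcount : perfectCount ν n X =
        (Finset.univ.filter fun σ : Fin n → Fin ν =>
          ∀ β, (ν * blockSum X σ β - ∑ j, X j : ℤ) = 0).card := by
      rw [perfectCount, ← Set.ncard_coe_finset]
      congr 1
      ext σ
      simpa [blockSum] using (hfreq σ).symm
    simp_rw [integral_cube_prod_exp_int_mul_I, Fintype.card_fin]
    rw [← Finset.sum_filter, Finset.sum_const, nsmul_eq_mul, ← hcount, one_div,
      Complex.ofReal_inv, Complex.ofReal_natCast]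
    field_simp
  · intro σ _
    exact ContinuousOn.integrableOn_compact (isCompact_univ_pi fun _ => isCompact_Icc)
      (Continuous.continuousOn (by fun_prop))
end

section
/- Fix an integer ν ≥ 3 and positive integers n, M. Let X_1,…,X_n be independent random variables, each uniformly distributed on {1,…,M}, let Z_n be the number of perfect ordered partitions, and let X be uniformly distributed on {1,…,M}. Then E[Z_n] = (2π)^{−ν} ∫_{[−π,π]^ν} ( E[f(x, X)] )^n dx, where y_α(x) := ν·x_α − Σ_{β=1}^ν x_β and f(x, η) := Σ_{α=1}^ν exp(i·y_α(x)·η). -/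
open MeasureTheory

/-- Orthogonality of the characters `x ↦ exp (i k x)` on `[-π, π]`. -/
theorem setIntegral_Icc_cexp_intCast (k : ℤ) :
    ∫ x : ℝ in Set.Icc (-Real.pi) Real.pi, Complex.exp (Complex.I * (x * k)) =
      if k = 0 then 2 * (Real.pi : ℂ) else 0 := by
  rw [integral_Icc_eq_integral_Ioc,
    ← intervalIntegral.integral_of_le (by linarith [Real.pi_pos])]
  split_ifs with hk
  · simp [hk]; ring
  · have hc : Complex.I * (k : ℂ) ≠ 0 := by simp [hk]
    have h : ∀ x : ℝ, Complex.exp (Complex.I * (x * k)) =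
        Complex.exp (Complex.I * k * x) := fun x => by ring_nf
    simp_rw [h]
    rw [integral_exp_mul_complex hc, div_eq_zero_iff]
    left
    rw [sub_eq_zero, Complex.exp_eq_exp_iff_exists_int]
    exact ⟨k, by push_cast; ring⟩

/-- Orthogonality of the characters of the torus on `[-π, π]^ν`. -/
theorem setIntegral_pi_Icc_cexp_intCast {ν : ℕ} (k : Fin ν → ℤ) :
    ∫ x : Fin ν → ℝ in Set.univ.pi fun _ : Fin ν => Set.Icc (-Real.pi) Real.pi,
        Complex.exp (Complex.I * ∑ β, (x β : ℂ) * k β) =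
      if ∀ β, k β = 0 then (2 * (Real.pi : ℂ)) ^ ν else 0 := by
  simp_rw [Finset.mul_sum, Complex.exp_sum]
  rw [volume_pi, Measure.restrict_pi_pi,
    integral_fintype_prod_eq_prod (fun β (t : ℝ) => Complex.exp (Complex.I * (t * k β)))]
  simp_rw [setIntegral_Icc_cexp_intCast]
  rw [Finset.prod_ite_zero]
  simp

/-- The sums of the blocks of `σ` are all equal exactly when each equals the average. -/
theorem forall_fiber_sum_eq_iff {ν n : ℕ} (X : Fin n → ℕ) (σ : Fin n → Fin ν) :
    (∀ α β : Fin ν, (∑ j with σ j = α, X j) = ∑ j with σ j = β, X j) ↔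
      ∀ β : Fin ν, (ν : ℤ) * (∑ j with σ j = β, X j : ℕ) - (∑ j, X j : ℕ) = 0 := by
  constructor
  · intro h β
    rw [← Finset.sum_fiberwise Finset.univ σ X,
      Finset.sum_congr rfl fun α _ => h α β]
    simp
  · intro h α β
    have hν : (ν : ℤ) ≠ 0 := by
      have := α.pos
      omega
    have := mul_left_cancel₀ hν ((sub_eq_zero.1 (h α)).trans (sub_eq_zero.1 (h β)).symm)
    exact_mod_cast this

/-- For positive weights, a map with equal block sums has no empty block. -/
theorem surjective_of_fiber_sum_eq {ν n : ℕ} (hn : 1 ≤ n) {X : Fin n → ℕ}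
    (hX : ∀ j, 0 < X j) {σ : Fin n → Fin ν}
    (h : ∀ α β : Fin ν, (∑ j with σ j = α, X j) = ∑ j with σ j = β, X j) :
    Function.Surjective σ := by
  intro α
  by_contra! hα
  have h0 := h (σ ⟨0, hn⟩) α
  rw [Finset.filter_false_of_mem (fun j _ => hα j), Finset.sum_empty,
    Finset.sum_eq_zero_iff] at h0
  exact (hX ⟨0, hn⟩).ne' (h0 _ (by simp))

theorem perfectCount_eq_sum {ν n : ℕ} (hn : 1 ≤ n) {X : Fin n → ℕ} (hX : ∀ j, 0 < X j) :
    (perfectCount ν n X : ℂ) = ∑ σ : Fin n → Fin ν,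
      if ∀ β : Fin ν, (ν : ℤ) * (∑ j with σ j = β, X j : ℕ) - (∑ j, X j : ℕ) = 0
        then 1 else 0 := by
  rw [Finset.sum_boole, perfectCount, ← Set.ncard_coe_finset]
  congr 2
  ext σ
  simp only [Set.mem_ofPred_eq, Finset.coe_filter, Finset.mem_univ, true_and,
    ← forall_fiber_sum_eq_iff]
  exact ⟨fun h => h.2, fun h => ⟨surjective_of_fiber_sum_eq hn hX h, h⟩⟩

/-- Collecting the total phase coordinate by coordinate. -/
theorem sum_phase_eq {ν n : ℕ} (X : Fin n → ℕ) (σ : Fin n → Fin ν) (x : Fin ν → ℝ) :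
    ∑ j, Complex.I * (((ν : ℝ) * x (σ j) - ∑ β : Fin ν, x β : ℝ) : ℂ) * (X j : ℂ) =
      Complex.I * ∑ β, (x β : ℂ) *
        (((ν : ℤ) * (∑ j with σ j = β, X j : ℕ) - (∑ j, X j : ℕ) : ℤ) : ℂ) := by
  have h : ∑ β, (x β : ℂ) * ∑ j with σ j = β, (X j : ℂ) = ∑ j, (x (σ j) : ℂ) * X j := by
    rw [← Finset.sum_fiberwise Finset.univ σ]
    refine Finset.sum_congr rfl fun β _ => ?_
    rw [Finset.mul_sum]
    exact Finset.sum_congr rfl fun j hj => by rw [(Finset.mem_filter.1 hj).2]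
  push_cast
  calc _ = Complex.I * ((ν : ℂ) * ∑ j, (x (σ j) : ℂ) * X j -
        (∑ β, (x β : ℂ)) * ∑ j, (X j : ℂ)) := by
        rw [Finset.mul_sum _ _ (ν : ℂ), Finset.mul_sum _ _ (∑ β, (x β : ℂ)),
          ← Finset.sum_sub_distrib, Finset.mul_sum]
        exact Finset.sum_congr rfl fun j _ => by ring
    _ = _ := by
        rw [← h, Finset.mul_sum _ _ (ν : ℂ), Finset.sum_mul, ← Finset.sum_sub_distrib]
        congr 1
        exact Finset.sum_congr rfl fun β _ => by ring

/-- Expansion of the `n`-th power of the averaged exponential sum over all outcomes and all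
assignments of indices to blocks. -/
theorem sum_cexp_pow_eq {ν : ℕ} (n M : ℕ) (x : Fin ν → ℝ) :
    ((1 / (M : ℂ)) * ∑ m ∈ Finset.Icc 1 M, ∑ α : Fin ν,
        Complex.exp (Complex.I *
          (((ν : ℝ) * x α - ∑ β : Fin ν, x β : ℝ) : ℂ) * (m : ℂ))) ^ n =
      (1 / (M : ℂ) ^ n) * ∑ X : Fin n → Fin M, ∑ σ : Fin n → Fin ν,
        Complex.exp (Complex.I * ∑ β, (x β : ℂ) *
          (((ν : ℤ) * (∑ j with σ j = β, ((X j : ℕ) + 1) : ℕ) -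
            (∑ j, ((X j : ℕ) + 1) : ℕ) : ℤ) : ℂ)) := by
  have hIcc (f : ℕ → ℂ) : ∑ m ∈ Finset.Icc 1 M, f m = ∑ m : Fin M, f ((m : ℕ) + 1) := by
    rw [Fin.sum_univ_eq_sum_range (fun m => f (m + 1)), Finset.range_eq_Ico,
      Finset.sum_Ico_add' f 0 M 1]
    rfl
  rw [mul_pow, one_div_pow, hIcc, Fintype.sum_pow]
  congr 1
  refine Finset.sum_congr rfl fun X _ => ?_
  rw [Finset.prod_univ_sum, Fintype.piFinset_univ]
  refine Finset.sum_congr rfl fun σ _ => ?_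
  rw [← Complex.exp_sum, sum_phase_eq (fun j => (X j : ℕ) + 1)]

theorem integral_formula_for_expectation
    (ν n M : ℕ) (hν : 3 ≤ ν) (hn : 1 ≤ n) (hM : 1 ≤ M) :
    ((EZ ν n M : ℝ) : ℂ) =
      (((1 : ℝ) / (2 * Real.pi) ^ ν : ℝ) : ℂ) *
        ∫ x : Fin ν → ℝ in Set.univ.pi fun _ : Fin ν => Set.Icc (-Real.pi) Real.pi,
          ((1 / (M : ℂ)) * ∑ m ∈ Finset.Icc 1 M, ∑ α : Fin ν,
            Complex.exp (Complex.I *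
              (((ν : ℝ) * x α - ∑ β : Fin ν, x β : ℝ) : ℂ) * (m : ℂ))) ^ n := by
  have hint (k : Fin ν → ℤ) : IntegrableOn
      (fun x : Fin ν → ℝ => Complex.exp (Complex.I * ∑ β, (x β : ℂ) * k β))
      (Set.univ.pi fun _ : Fin ν => Set.Icc (-Real.pi) Real.pi) :=
    ContinuousOn.integrableOn_compact (isCompact_univ_pi fun _ => isCompact_Icc)
      (by fun_prop)
  have hpi : (2 * (Real.pi : ℂ)) ^ ν ≠ 0 := by simp [Real.pi_ne_zero]
  simp_rw [sum_cexp_pow_eq]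
  rw [integral_const_mul, integral_finsetSum _ fun X _ =>
    integrable_finsetSum _ fun σ _ => hint _]
  simp_rw [integral_finsetSum _ fun σ _ => hint _, setIntegral_pi_Icc_cexp_intCast, EZ]
  push_cast
  simp_rw [perfectCount_eq_sum hn (fun j => Nat.succ_pos _)]
  rw [mul_left_comm, div_eq_mul_one_div, mul_comm]
  congr 1
  rw [Finset.mul_sum]
  refine Finset.sum_congr rfl fun X _ => ?_
  rw [Finset.mul_sum]
  refine Finset.sum_congr rfl fun σ _ => ?_
  push_cast
  split_ifs <;> simp [hpi]
end

section
/- Fix an integer ν ≥ 3 and positive integers n, M. Let X_1,…,X_n be independent random variables, each uniformly distributed on {1,…,M}, let Z_n be the number of perfect ordered partitions, and let X be uniformly distributed on {1,…,M}. Then E[Z_n²] = (2π)^{−2ν} ∫_{[−π,π]^ν × [−π,π]^ν} ( E[ f(x, X) · conj(f(x', X)) ] )^n dx dx', where y_α(x) := ν·x_α − Σ_{β=1}^ν x_β, f(x, η) := Σ_{α=1}^ν exp(i·y_α(x)·η), and conj denotes complex conjugation. -/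
open MeasureTheory

/-- `E[Z_n²]` for `X_1,…,X_n` i.i.d. uniform on `{1,…,M}`. -/
noncomputable def EZsq (ν n M : ℕ) : ℝ :=
  (∑ X : Fin n → Fin M, ((perfectCount ν n fun j => (X j : ℕ) + 1) : ℝ) ^ 2) / (M : ℝ) ^ n

/-- `f(x, η) = Σ_α exp(i·(ν·x_α − Σ_β x_β)·η)`. -/
noncomputable def fker (ν : ℕ) (x : Fin ν → ℝ) (η : ℝ) : ℂ :=
  ∑ α : Fin ν,
    Complex.exp (Complex.I * (((ν : ℝ) * x α - ∑ β : Fin ν, x β : ℝ) : ℂ) * (η : ℂ))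

local notation "piBox" ν:max => Set.pi Set.univ fun _ : Fin ν => Set.Icc (-Real.pi) Real.pi

lemma setIntegral_exp_int_mul (k : ℤ) :
    ∫ x in Set.Icc (-Real.pi) Real.pi, Complex.exp (Complex.I * (k : ℂ) * (x : ℂ)) =
      if k = 0 then ((2 * Real.pi : ℝ) : ℂ) else 0 := by
  rw [integral_Icc_eq_integral_Ioc,
    ← intervalIntegral.integral_of_le (by linarith [Real.pi_pos])]
  split_ifs with hk
  · subst hk
    simp
    ring
  · have hc : Complex.I * (k : ℂ) ≠ 0 := by simp [hk]
    rw [integral_exp_mul_complex hc, div_eq_zero_iff]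
    left
    rw [sub_eq_zero, Complex.exp_eq_exp_iff_exists_int]
    exact ⟨k, by push_cast; ring⟩

lemma setIntegral_piBox_prod_exp (ν : ℕ) (k : Fin ν → ℤ) :
    ∫ x in piBox ν, ∏ β, Complex.exp (Complex.I * (k β : ℂ) * (x β : ℂ)) =
      if ∀ β, k β = 0 then ((2 * Real.pi : ℝ) : ℂ) ^ ν else 0 := by
  rw [volume_pi, Measure.restrict_pi_pi,
    integral_fintype_prod_eq_prod
      (f := fun β (t : ℝ) => Complex.exp (Complex.I * (k β : ℂ) * (t : ℂ)))]
  simp_rw [setIntegral_exp_int_mul]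
  split_ifs with h
  · simp [h]
  · push Not at h
    obtain ⟨β, hβ⟩ := h
    exact Finset.prod_eq_zero (Finset.mem_univ β) (if_neg hβ)

@[fun_prop]
lemma continuous_fker (ν : ℕ) (η : ℝ) : Continuous fun x => fker ν x η := by
  unfold fker
  fun_prop

lemma isCompact_piBox (ν : ℕ) : IsCompact (piBox ν) :=
  isCompact_univ_pi fun _ => isCompact_Icc

/-- The sum of the `X j` over the part of `σ` with label `α`. -/
def partSum {ν n : ℕ} (σ : Fin n → Fin ν) (X : Fin n → ℕ) (α : Fin ν) : ℕ :=
  ∑ j ∈ Finset.univ.filter fun j => σ j = α, X j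

lemma sum_partSum {ν n : ℕ} (σ : Fin n → Fin ν) (X : Fin n → ℕ) :
    ∑ α, partSum σ X α = ∑ j, X j :=
  Finset.sum_fiberwise _ _ _

lemma sum_mul_partSum {ν n : ℕ} (σ : Fin n → Fin ν) (X : Fin n → ℕ) (x : Fin ν → ℝ) :
    ∑ α, x α * partSum σ X α = ∑ j, x (σ j) * X j := by
  rw [← Finset.sum_fiberwise Finset.univ σ]
  refine Finset.sum_congr rfl fun α _ => ?_
  rw [partSum, Nat.cast_sum, Finset.mul_sum]
  refine Finset.sum_congr rfl fun j hj => ?_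
  rw [(Finset.mem_filter.mp hj).2]

lemma prod_fker_eq_sum {ν n : ℕ} (X : Fin n → ℕ) (x : Fin ν → ℝ) :
    ∏ j, fker ν x (X j) =
      ∑ σ : Fin n → Fin ν, ∏ β, Complex.exp
        (Complex.I * (((ν * partSum σ X β - ∑ j, X j : ℤ)) : ℂ) * (x β : ℂ)) := by
  unfold fker
  rw [Finset.prod_univ_sum, Fintype.piFinset_univ]
  refine Finset.sum_congr rfl fun σ _ => ?_
  rw [← Complex.exp_sum, ← Complex.exp_sum]
  congr 1
  have key : ∑ j, ((ν : ℝ) * x (σ j) - ∑ β, x β) * X j =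
      ∑ β, (ν * partSum σ X β - ∑ j, (X j : ℝ)) * x β := by
    simp only [sub_mul, Finset.sum_sub_distrib, mul_assoc, ← Finset.mul_sum]
    rw [← sum_mul_partSum, mul_comm (∑ β, x β)]
    simp only [mul_comm]
  have keyC := congrArg (fun r : ℝ => Complex.I * (r : ℂ)) key
  push_cast [Finset.mul_sum] at keyC ⊢
  simpa only [mul_assoc, Finset.mul_sum] using keyC

lemma surjective_and_partSum_eq_iff {ν n : ℕ} (hn : 1 ≤ n) {X : Fin n → ℕ}
    (hX : ∀ j, 1 ≤ X j) (σ : Fin n → Fin ν) :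
    (Function.Surjective σ ∧ ∀ α β, partSum σ X α = partSum σ X β) ↔
      ∀ β, (ν * partSum σ X β - ∑ j, X j : ℤ) = 0 := by
  have hcast (β : Fin ν) : (ν * partSum σ X β - ∑ j, X j : ℤ) = 0 ↔
      ν * partSum σ X β = ∑ j, X j := by
    rw [sub_eq_zero]
    norm_cast
  simp_rw [hcast]
  constructor
  · rintro ⟨-, h⟩ β
    rw [← sum_partSum σ, Finset.sum_congr rfl fun α _ => h α β]
    simp
  · intro h
    have hpos : 0 < ∑ j, X j :=
      Finset.sum_pos (fun j _ => hX j) ⟨⟨0, hn⟩, Finset.mem_univ _⟩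
    refine ⟨fun α => ?_, fun α β => ?_⟩
    · by_contra! hα
      have : partSum σ X α = 0 := by simp [partSum, hα]
      have := h α
      simp_all
    · exact Nat.eq_of_mul_eq_mul_left α.pos ((h α).trans (h β).symm)

lemma setIntegral_piBox_prod_fker {ν n : ℕ} (hn : 1 ≤ n) {X : Fin n → ℕ}
    (hX : ∀ j, 1 ≤ X j) :
    ∫ x in piBox ν, ∏ j, fker ν x (X j) =
      ((2 * Real.pi : ℝ) : ℂ) ^ ν * (perfectCount ν n X : ℂ) := by
  classical
  simp_rw [prod_fker_eq_sum]
  rw [integral_finsetSum _ fun σ _ => ContinuousOn.integrableOn_compact (isCompact_piBox ν)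
    (by fun_prop)]
  simp_rw [setIntegral_piBox_prod_exp, ← surjective_and_partSum_eq_iff hn hX]
  rw [← Finset.sum_filter, Finset.sum_const, nsmul_eq_mul, mul_comm, perfectCount,
    ← Set.ncard_coe_finset]
  simp only [Finset.coe_filter, Finset.mem_univ, true_and]
  rfl

lemma pow_average_eq_sum (ν n M : ℕ) (x y : Fin ν → ℝ) :
    ((1 / (M : ℂ)) * ∑ m ∈ Finset.Icc 1 M,
        fker ν x (m : ℝ) * (starRingEnd ℂ) (fker ν y (m : ℝ))) ^ n =
      (1 / (M : ℂ)) ^ n * ∑ X : Fin n → Fin M,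
        (∏ j, fker ν x (((X j : ℕ) + 1 : ℕ) : ℝ)) *
          (starRingEnd ℂ) (∏ j, fker ν y (((X j : ℕ) + 1 : ℕ) : ℝ)) := by
  rw [mul_pow, ← Finset.Ico_succ_right_eq_Icc, Finset.sum_Ico_eq_sum_range]
  simp only [Nat.succ_eq_succ, Nat.succ_eq_add_one, Nat.add_sub_cancel, add_comm 1]
  rw [Finset.sum_range fun k => fker ν x ((k + 1 : ℕ) : ℝ) *
    (starRingEnd ℂ) (fker ν y ((k + 1 : ℕ) : ℝ)), Fintype.sum_pow]
  simp only [map_prod, Finset.prod_mul_distrib]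

theorem integral_formula_for_second_moment
    (ν n M : ℕ) (hν : 3 ≤ ν) (hn : 1 ≤ n) (hM : 1 ≤ M) :
    ((EZsq ν n M : ℝ) : ℂ) =
      (((1 : ℝ) / (2 * Real.pi) ^ (2 * ν) : ℝ) : ℂ) *
        ∫ p : (Fin ν → ℝ) × (Fin ν → ℝ) in
            (Set.univ.pi fun _ : Fin ν => Set.Icc (-Real.pi) Real.pi) ×ˢ
            (Set.univ.pi fun _ : Fin ν => Set.Icc (-Real.pi) Real.pi),
          ((1 / (M : ℂ)) * ∑ m ∈ Finset.Icc 1 M,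
            fker ν p.1 (m : ℝ) * (starRingEnd ℂ) (fker ν p.2 (m : ℝ))) ^ n := by
  simp_rw [pow_average_eq_sum]
  rw [integral_const_mul, integral_finsetSum _ fun X _ => ContinuousOn.integrableOn_compact
    ((isCompact_piBox ν).prod (isCompact_piBox ν)) (Continuous.continuousOn ?_)]
  · have hX (X : Fin n → Fin M) := setIntegral_piBox_prod_fker (ν := ν) hn
      (X := fun j => (X j : ℕ) + 1) fun j => Nat.le_add_left 1 _
    have hprod (X : Fin n → Fin M) :=
      setIntegral_prod_mul (μ := (volume : Measure (Fin ν → ℝ)))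
        (ν := (volume : Measure (Fin ν → ℝ)))
        (fun x => ∏ j, fker ν x (((X j : ℕ) + 1 : ℕ) : ℝ))
        (fun y => (starRingEnd ℂ) (∏ j, fker ν y (((X j : ℕ) + 1 : ℕ) : ℝ)))
        (piBox ν) (piBox ν)
    simp_rw [integral_conj, hX] at hprod
    rw [← Measure.volume_eq_prod] at hprod
    simp_rw [hprod]
    have hpi : (Real.pi : ℂ) ≠ 0 := by exact_mod_cast Real.pi_ne_zero
    simp only [EZsq, map_mul, map_pow, Complex.conj_ofReal, Complex.conj_natCast]
    push_cast
    rw [one_div_pow, Finset.mul_sum, Finset.mul_sum, Finset.sum_div]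
    refine Finset.sum_congr rfl fun X _ => ?_
    have hM' : (M : ℂ) ≠ 0 := by exact_mod_cast (by omega : M ≠ 0)
    field_simp
    ring
  · have hconj : Continuous (starRingEnd ℂ) := Complex.continuous_conj
    fun_prop
end
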